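/- arXiv:2511.09365 — 5 statements merged into one kernel-verified Lean document; each statement's English description precedes it below -/
import Mathlib

section
/- There is an absolute constant C such that the following holds. Let N ≥ 2 and let q, q', H, H' ∈ ℕ with q | q' and H' ≤ H. Then for every 1-bounded f : ℤ → ℂ, 𝔼^log_{n∈[N]} |Π_{q',H'}f(n) − Π_{q,H}f(n)|² ≤ 𝔼^log_{n∈[N]} |Π_{q',H'}f(n)|² − 𝔼^log_{n∈[N]} |Π_{q,H}f(n)|² + C·( log(q'H)/log N + (q'H')/(qH) ). -/
noncomputable section

open Finset

/-- Uniform average of a complex-valued function over a finite set. -/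
def avgC {α : Type*} (s : Finset α) (f : α → ℂ) : ℂ := (∑ x ∈ s, f x) / s.card

/-- Logarithmic average of a real-valued function over a finite set of naturals. -/
def logAvgR (s : Finset ℕ) (f : ℕ → ℝ) : ℝ :=
  (∑ n ∈ s, f n / (n : ℝ)) / (∑ n ∈ s, (1 : ℝ) / (n : ℝ))

/-- The averaging projection `Π_{q,H} f (n) = 𝔼_{h, h' ∈ [H]} f (n + q (h − h'))`. -/
def proj (q H : ℕ) (f : ℤ → ℂ) (n : ℤ) : ℂ :=
  avgC (Finset.Icc 1 H) (fun h => avgC (Finset.Icc 1 H) (fun h' =>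
    f (n + (q : ℤ) * ((h : ℤ) - (h' : ℤ)))))

theorem sum_Icc_one_eq_sum_range {M : Type*} [AddCommMonoid M] (F : ℕ → M) (N : ℕ) :
    ∑ n ∈ Icc 1 N, F n = ∑ n ∈ range N, F (n + 1) := by
  induction N with
  | zero => simp
  | succ N ih => rw [Finset.sum_Icc_succ_top (by omega), ih, Finset.sum_range_succ]

theorem abs_sum_shift_div_sub_le (G : ℤ → ℝ) (hG : ∀ n, |G n| ≤ 1) (N k : ℕ) :
    |∑ n ∈ range N, G ((n : ℤ) + 1 + k) / ((n : ℝ) + 1) -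
        ∑ n ∈ range N, G ((n : ℤ) + 1) / ((n : ℝ) + 1)| ≤
      2 * ∑ n ∈ range k, 1 / ((n : ℝ) + 1) := by
  set b : ℕ → ℝ := fun n => 1 / ((n : ℝ) + 1) with hb
  set a : ℕ → ℝ := fun n => G ((n : ℤ) + 1) / ((n : ℝ) + 1) with ha
  have hab : ∀ n, |a n| ≤ b n := fun n => by
    have h : (0 : ℝ) < (n : ℝ) + 1 := by positivity
    simp only [ha, hb, abs_div, abs_of_pos h]
    gcongr
    exact hG _
  have a1 := Finset.sum_range_add a N k
  have a2 := Finset.sum_range_add a k N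
  have b1 := Finset.sum_range_add b N k
  have b2 := Finset.sum_range_add b k N
  rw [add_comm k N] at a2 b2
  have h1 : |∑ n ∈ range N, G ((n : ℤ) + 1 + k) / ((n : ℝ) + 1) - ∑ n ∈ range N, a (k + n)| ≤
      ∑ n ∈ range N, b n - ∑ n ∈ range N, b (k + n) := by
    rw [← Finset.sum_sub_distrib, ← Finset.sum_sub_distrib]
    refine (Finset.abs_sum_le_sum_abs _ _).trans (Finset.sum_le_sum fun n _ => ?_)
    have e : G ((n : ℤ) + 1 + k) / ((n : ℝ) + 1) - a (k + n) =
        G ((n : ℤ) + 1 + k) * (b n - b (k + n)) := by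
      have : (((k + n : ℕ) : ℤ) + 1) = (n : ℤ) + 1 + k := by push_cast; ring
      simp only [ha, hb, this]
      ring
    have hle : b (k + n) ≤ b n := by
      simp only [hb]
      apply one_div_le_one_div_of_le (by positivity)
      push_cast
      linarith [(Nat.cast_nonneg k : (0 : ℝ) ≤ k)]
    rw [e, abs_mul, abs_of_nonneg (sub_nonneg.2 hle)]
    exact mul_le_of_le_one_left (sub_nonneg.2 hle) (hG _)
  have h2 : |∑ n ∈ range k, a (N + n)| ≤ ∑ n ∈ range k, b (N + n) :=
    (Finset.abs_sum_le_sum_abs _ _).trans (Finset.sum_le_sum fun n _ => hab _)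
  have h3 : |∑ n ∈ range k, a n| ≤ ∑ n ∈ range k, b n :=
    (Finset.abs_sum_le_sum_abs _ _).trans (Finset.sum_le_sum fun n _ => hab _)
  rw [abs_le] at *
  constructor <;> linarith [h1.1, h1.2, h2.1, h2.2, h3.1, h3.2]

theorem log_le_sum_Icc_one_div (N : ℕ) (hN : 0 < N) :
    Real.log N ≤ ∑ n ∈ Icc 1 N, (1 : ℝ) / (n : ℝ) := by
  have h := log_add_one_le_harmonic N
  have e : ((harmonic N : ℚ) : ℝ) = ∑ n ∈ Icc 1 N, (1 : ℝ) / (n : ℝ) := by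
    rw [sum_Icc_one_eq_sum_range]; simp [harmonic]
  rw [← e]
  refine (Real.log_le_log (by exact_mod_cast hN) ?_).trans h
  push_cast
  linarith

theorem sum_range_one_div_le (k : ℕ) :
    ∑ n ∈ range k, 1 / ((n : ℝ) + 1) ≤ 1 + Real.log k := by
  have h := harmonic_le_one_add_log k
  simpa [harmonic] using h

theorem abs_logAvgR_shift_sub_le (G : ℤ → ℝ) (hG : ∀ n, |G n| ≤ 1) {N : ℕ} (hN : 2 ≤ N)
    (k : ℕ) :
    |logAvgR (Icc 1 N) (fun n => G ((n : ℤ) + k)) - logAvgR (Icc 1 N) (fun n => G (n : ℤ))| ≤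
      2 * (1 + Real.log k) / Real.log N := by
  have hlog : 0 < Real.log N := Real.log_pos (by exact_mod_cast hN)
  have hW := log_le_sum_Icc_one_div N (by omega)
  have hs := abs_sum_shift_div_sub_le G hG N k
  have hk := sum_range_one_div_le k
  unfold logAvgR
  rw [← sub_div, abs_div, abs_of_pos (hlog.trans_le hW)]
  have hn : |∑ n ∈ Icc 1 N, G ((n : ℤ) + k) / (n : ℝ) - ∑ n ∈ Icc 1 N, G (n : ℤ) / (n : ℝ)| ≤
      2 * (1 + Real.log k) := by
    rw [sum_Icc_one_eq_sum_range, sum_Icc_one_eq_sum_range]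
    push_cast
    linarith
  exact div_le_div₀ ((abs_nonneg _).trans hn) hn hlog hW

theorem logAvgR_mono {s : Finset ℕ} {f g : ℕ → ℝ} (h : ∀ n, f n ≤ g n) :
    logAvgR s f ≤ logAvgR s g := by
  unfold logAvgR
  gcongr with n
  exact h n

theorem logAvgR_add (s : Finset ℕ) (f g : ℕ → ℝ) :
    logAvgR s (fun n => f n + g n) = logAvgR s f + logAvgR s g := by
  simp only [logAvgR, add_div, Finset.sum_add_distrib]

theorem logAvgR_const_mul (s : Finset ℕ) (c : ℝ) (f : ℕ → ℝ) :
    logAvgR s (fun n => c * f n) = c * logAvgR s f := by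
  simp only [logAvgR, mul_div_assoc, ← Finset.mul_sum]

theorem logAvgR_sum {α : Type*} (s : Finset ℕ) (t : Finset α) (F : α → ℕ → ℝ) :
    logAvgR s (fun n => ∑ h ∈ t, F h n) = ∑ h ∈ t, logAvgR s (F h) := by
  simp only [logAvgR, Finset.sum_div]
  rw [Finset.sum_comm]

theorem logAvgR_const_le {s : Finset ℕ} {c : ℝ} (hc : 0 ≤ c) :
    logAvgR s (fun _ => c) ≤ c := by
  have h : logAvgR s (fun _ => c) =
      c * ((∑ n ∈ s, (1 : ℝ) / (n : ℝ)) / (∑ n ∈ s, (1 : ℝ) / (n : ℝ))) := by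
    rw [← mul_div_assoc, Finset.mul_sum]
    simp only [logAvgR, mul_one_div]
  rw [h]
  exact mul_le_of_le_one_right hc (div_self_le_one _)

theorem norm_avgC_le {α : Type*} (s : Finset α) (f : α → ℂ) {c : ℝ} (hc : 0 ≤ c)
    (h : ∀ x ∈ s, ‖f x‖ ≤ c) : ‖avgC s f‖ ≤ c := by
  rw [avgC, norm_div, Complex.norm_natCast]
  refine div_le_of_le_mul₀ (by positivity) hc ?_
  refine (norm_sum_le _ _).trans ((Finset.sum_le_sum h).trans ?_)
  rw [Finset.sum_const, nsmul_eq_mul, mul_comm]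

theorem avgC_sub {α : Type*} (s : Finset α) (f g : α → ℂ) :
    avgC s f - avgC s g = avgC s (fun x => f x - g x) := by
  simp only [avgC, Finset.sum_sub_distrib, sub_div]

theorem avgC_comm {α β : Type*} (s : Finset α) (t : Finset β) (f : α → β → ℂ) :
    avgC s (fun x => avgC t (f x)) = avgC t (fun y => avgC s (fun x => f x y)) := by
  simp only [avgC, ← Finset.sum_div]
  rw [Finset.sum_comm, div_right_comm]

theorem avgC_const {α : Type*} {s : Finset α} (hs : s.Nonempty) (c : ℂ) :
    avgC s (fun _ => c) = c := by
  have : (s.card : ℂ) ≠ 0 := by exact_mod_cast hs.card_pos.ne'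
  simp [avgC, this]

theorem re_mul_conj_avgC {α : Type*} (s : Finset α) (z : ℂ) (f : α → ℂ) :
    (z * (starRingEnd ℂ) (avgC s f)).re =
      (s.card : ℝ)⁻¹ * ∑ x ∈ s, (z * (starRingEnd ℂ) (f x)).re := by
  have h : z * (starRingEnd ℂ) (avgC s f) =
      ((s.card : ℝ)⁻¹ : ℝ) * ∑ x ∈ s, z * (starRingEnd ℂ) (f x) := by
    simp only [avgC, map_div₀, map_sum, Complex.conj_natCast, ← Finset.mul_sum]
    push_cast
    ring
  rw [h, Complex.re_ofReal_mul, Complex.re_sum]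

theorem re_avgC_mul_conj {α : Type*} (s : Finset α) (z : ℂ) (f : α → ℂ) :
    (avgC s f * (starRingEnd ℂ) z).re =
      (s.card : ℝ)⁻¹ * ∑ x ∈ s, (f x * (starRingEnd ℂ) z).re := by
  have h : avgC s f * (starRingEnd ℂ) z =
      ((s.card : ℝ)⁻¹ : ℝ) * ∑ x ∈ s, f x * (starRingEnd ℂ) z := by
    simp only [avgC, ← Finset.sum_mul]
    push_cast
    ring
  rw [h, Complex.re_ofReal_mul, Complex.re_sum]

theorem norm_avgC_sq_le {α : Type*} (s : Finset α) (f : α → ℂ) :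
    ‖avgC s f‖ ^ 2 ≤ (s.card : ℝ)⁻¹ * ∑ x ∈ s, ‖f x‖ ^ 2 := by
  rcases s.eq_empty_or_nonempty with rfl | hs
  · simp [avgC]
  have hc : (0 : ℝ) < s.card := by exact_mod_cast hs.card_pos
  rw [avgC, norm_div, Complex.norm_natCast, div_pow, inv_mul_eq_div,
    div_le_div_iff₀ (by positivity) hc]
  have h1 : ‖∑ x ∈ s, f x‖ ^ 2 ≤ (∑ x ∈ s, ‖f x‖) ^ 2 := by
    gcongr
    exact norm_sum_le _ _
  have h2 := sq_sum_le_card_mul_sum_sq (s := s) (f := fun x => ‖f x‖)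
  nlinarith

theorem norm_sum_shift_sub_le (u : ℤ → ℂ) (hu : ∀ n, ‖u n‖ ≤ 1) (H : ℕ) (k : ℕ) (c : ℤ) :
    ‖∑ h ∈ Icc 1 H, u ((h : ℤ) + (c + k)) - ∑ h ∈ Icc 1 H, u ((h : ℤ) + c)‖ ≤ 2 * k := by
  induction k with
  | zero => simp
  | succ k ih =>
    have h1 : ‖∑ h ∈ Icc 1 H, u ((h : ℤ) + (c + (k + 1 : ℕ))) -
        ∑ h ∈ Icc 1 H, u ((h : ℤ) + (c + k))‖ ≤ 2 := by
      rw [sum_Icc_one_eq_sum_range, sum_Icc_one_eq_sum_range, ← Finset.sum_sub_distrib]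
      have e := Finset.sum_range_sub (fun n : ℕ => u ((n : ℤ) + 1 + (c + k))) H
      have e' : ∑ n ∈ range H, (u (((n + 1 : ℕ) : ℤ) + (c + (k + 1 : ℕ))) -
          u (((n + 1 : ℕ) : ℤ) + (c + k))) =
          ∑ n ∈ range H, (u (((n + 1 : ℕ) : ℤ) + 1 + (c + k)) - u ((n : ℤ) + 1 + (c + k))) := by
        refine Finset.sum_congr rfl fun n _ => ?_
        congr 2
        push_cast
        ring
      rw [e', e]
      have u1 := hu ((H : ℤ) + 1 + (c + k))
      have u2 := hu (((0 : ℕ) : ℤ) + 1 + (c + k))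
      exact (norm_sub_le _ _).trans (by linarith)
    have h2 := norm_sub_le_norm_sub_add_norm_sub
      (∑ h ∈ Icc 1 H, u ((h : ℤ) + (c + (k + 1 : ℕ)))) (∑ h ∈ Icc 1 H, u ((h : ℤ) + (c + k)))
      (∑ h ∈ Icc 1 H, u ((h : ℤ) + c))
    push_cast at *
    linarith

theorem norm_avgC_shift_sub_le (u : ℤ → ℂ) (hu : ∀ n, ‖u n‖ ≤ 1) (H : ℕ) (j : ℤ) :
    ‖avgC (Icc 1 H) (fun h => u ((h : ℤ) + j)) - avgC (Icc 1 H) (fun h => u (h : ℤ))‖ ≤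
      2 * |(j : ℝ)| / H := by
  have key : ‖∑ h ∈ Icc 1 H, u ((h : ℤ) + j) - ∑ h ∈ Icc 1 H, u (h : ℤ)‖ ≤ 2 * |(j : ℝ)| := by
    obtain ⟨k, rfl | rfl⟩ := j.eq_nat_or_neg
    · simpa using norm_sum_shift_sub_le u hu H k 0
    · rw [norm_sub_rev]
      simpa using norm_sum_shift_sub_le u hu H k (-k)
  rw [avgC, avgC, ← sub_div, norm_div, Complex.norm_natCast]
  simp only [Nat.card_Icc, Nat.add_sub_cancel]
  gcongr

theorem norm_proj_le (q H : ℕ) (f : ℤ → ℂ) (hf : ∀ n, ‖f n‖ ≤ 1) (n : ℤ) :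
    ‖proj q H f n‖ ≤ 1 :=
  norm_avgC_le _ _ zero_le_one fun _ _ => norm_avgC_le _ _ zero_le_one fun _ _ => hf _

/-- The one-sided average of `f` over the progression `n - q, n - 2q, …, n - Hq`. -/
def backAvg (q H : ℕ) (f : ℤ → ℂ) (n : ℤ) : ℂ :=
  avgC (Icc 1 H) (fun h => f (n - (q : ℤ) * (h : ℤ)))

theorem norm_backAvg_le (q H : ℕ) (f : ℤ → ℂ) (hf : ∀ n, ‖f n‖ ≤ 1) (n : ℤ) :
    ‖backAvg q H f n‖ ≤ 1 :=
  norm_avgC_le _ _ zero_le_one fun _ _ => hf _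

theorem proj_eq_avgC_backAvg (q H : ℕ) (f : ℤ → ℂ) (n : ℤ) :
    proj q H f n = avgC (Icc 1 H) (fun h => backAvg q H f (n + ((q * h : ℕ) : ℤ))) := by
  unfold proj backAvg
  congr 1 with h
  congr 1 with h'
  congr 1
  push_cast
  ring

theorem norm_backAvg_proj_sub_le (q d H H' : ℕ) (hH' : 0 < H') (f : ℤ → ℂ)
    (hf : ∀ n, ‖f n‖ ≤ 1) (n : ℤ) :
    ‖backAvg q H (proj (q * d) H' f) n - backAvg q H f n‖ ≤ 2 * (d * H') / H := by
  have hne : (Icc 1 H').Nonempty := Finset.nonempty_Icc.2 hH'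
  have e1 : backAvg q H (proj (q * d) H' f) n =
      avgC (Icc 1 H') (fun h1 => avgC (Icc 1 H') (fun h2 => avgC (Icc 1 H) (fun h =>
        f (n - (q : ℤ) * (h : ℤ) + ((q * d : ℕ) : ℤ) * ((h1 : ℤ) - (h2 : ℤ)))))) := by
    unfold backAvg proj
    rw [avgC_comm]
    congr 1 with h1
    rw [avgC_comm]
  have e2 : backAvg q H f n =
      avgC (Icc 1 H') (fun _ => avgC (Icc 1 H') (fun _ => backAvg q H f n)) := by
    rw [avgC_const hne, avgC_const hne]
  rw [e1, e2, avgC_sub]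
  refine norm_avgC_le _ _ (by positivity) fun h1 hh1 => ?_
  rw [avgC_sub]
  refine norm_avgC_le _ _ (by positivity) fun h2 hh2 => ?_
  rw [Finset.mem_Icc] at hh1 hh2
  have hs := norm_avgC_shift_sub_le (fun m => f (n - (q : ℤ) * m)) (fun _ => hf _) H
    (-((d : ℤ) * ((h1 : ℤ) - (h2 : ℤ))))
  have e3 : avgC (Icc 1 H) (fun h =>
        f (n - (q : ℤ) * (h : ℤ) + ((q * d : ℕ) : ℤ) * ((h1 : ℤ) - (h2 : ℤ)))) =
      avgC (Icc 1 H) (fun h =>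
        f (n - (q : ℤ) * ((h : ℤ) + -((d : ℤ) * ((h1 : ℤ) - (h2 : ℤ)))))) := by
    congr 1 with h
    congr 1
    push_cast
    ring
  rw [e3]
  refine hs.trans ?_
  have hj : |((h1 : ℝ) - h2)| ≤ H' := by
    have b1 : (h1 : ℝ) ≤ H' := by exact_mod_cast hh1.2
    have b2 : (h2 : ℝ) ≤ H' := by exact_mod_cast hh2.2
    rw [abs_le]
    constructor <;> linarith [(Nat.cast_nonneg h1 : (0 : ℝ) ≤ h1),
      (Nat.cast_nonneg h2 : (0 : ℝ) ≤ h2)]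
  push_cast
  rw [abs_neg, abs_mul, Nat.abs_cast]
  gcongr

theorem inv_card_mul_sum_le {α : Type*} {s : Finset α} (hs : s.Nonempty) {a : α → ℝ} {c : ℝ}
    (h : ∀ x ∈ s, a x ≤ c) : (s.card : ℝ)⁻¹ * ∑ x ∈ s, a x ≤ c := by
  have hc : (0 : ℝ) < s.card := by exact_mod_cast hs.card_pos
  rw [inv_mul_le_iff₀ hc]
  exact (Finset.sum_le_sum h).trans (by simp)

theorem logAvgR_norm_proj_sq_le {N q H : ℕ} (hN : 2 ≤ N) (hq : 0 < q) (hH : 0 < H)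
    (f : ℤ → ℂ) (hf : ∀ n, ‖f n‖ ≤ 1) :
    logAvgR (Icc 1 N) (fun n => ‖proj q H f (n : ℤ)‖ ^ 2) ≤
      logAvgR (Icc 1 N) (fun n => ‖backAvg q H f (n : ℤ)‖ ^ 2) +
        2 * (1 + Real.log (q * H)) / Real.log N := by
  have hlog : 0 < Real.log N := Real.log_pos (by exact_mod_cast hN)
  have h1 : logAvgR (Icc 1 N) (fun n => ‖proj q H f (n : ℤ)‖ ^ 2) ≤
      logAvgR (Icc 1 N) (fun n => ((Icc 1 H).card : ℝ)⁻¹ *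
        ∑ h ∈ Icc 1 H, ‖backAvg q H f ((n : ℤ) + ((q * h : ℕ) : ℤ))‖ ^ 2) :=
    logAvgR_mono fun n => by
      rw [proj_eq_avgC_backAvg]
      exact norm_avgC_sq_le _ _
  refine h1.trans ?_
  rw [logAvgR_const_mul, logAvgR_sum]
  refine inv_card_mul_sum_le (Finset.nonempty_Icc.2 hH) fun h hh => ?_
  rw [Finset.mem_Icc] at hh
  have hs := abs_logAvgR_shift_sub_le (fun n => ‖backAvg q H f n‖ ^ 2) (fun n => by
    rw [abs_of_nonneg (by positivity)]
    exact pow_le_one₀ (norm_nonneg _) (norm_backAvg_le q H f hf n)) hN (q * h)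
  have hm : 2 * (1 + Real.log ((q * h : ℕ) : ℝ)) / Real.log N ≤
      2 * (1 + Real.log (q * H)) / Real.log N := by
    have : (0 : ℝ) < ((q * h : ℕ) : ℝ) := by exact_mod_cast Nat.mul_pos hq hh.1
    gcongr
    push_cast
    gcongr
    exact hh.2
  linarith [(abs_le.1 hs).2]

theorem le_logAvgR_re_mul_conj_proj {N q H : ℕ} (hN : 2 ≤ N) (hq : 0 < q) (hH : 0 < H)
    (A f : ℤ → ℂ) (hA : ∀ n, ‖A n‖ ≤ 1) (hf : ∀ n, ‖f n‖ ≤ 1) :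
    logAvgR (Icc 1 N)
        (fun n => (backAvg q H A (n : ℤ) * (starRingEnd ℂ) (backAvg q H f (n : ℤ))).re) ≤
      logAvgR (Icc 1 N) (fun n => (A (n : ℤ) * (starRingEnd ℂ) (proj q H f (n : ℤ))).re) +
        2 * (1 + Real.log (q * H)) / Real.log N := by
  have hlog : 0 < Real.log N := Real.log_pos (by exact_mod_cast hN)
  have hne : (Icc 1 H).Nonempty := Finset.nonempty_Icc.2 hH
  have e1 : ∀ n : ℤ, (backAvg q H A n * (starRingEnd ℂ) (backAvg q H f n)).re =
      ((Icc 1 H).card : ℝ)⁻¹ * ∑ h ∈ Icc 1 H,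
        (A (n - (q : ℤ) * (h : ℤ)) * (starRingEnd ℂ) (backAvg q H f n)).re := fun n => by
    rw [← re_avgC_mul_conj]
    rfl
  have e2 : ∀ n : ℤ, (A n * (starRingEnd ℂ) (proj q H f n)).re =
      ((Icc 1 H).card : ℝ)⁻¹ * ∑ h ∈ Icc 1 H,
        (A n * (starRingEnd ℂ) (backAvg q H f (n + ((q * h : ℕ) : ℤ)))).re := fun n => by
    rw [← re_mul_conj_avgC, ← proj_eq_avgC_backAvg]
  simp only [e1, e2]
  rw [logAvgR_const_mul, logAvgR_sum, logAvgR_const_mul, logAvgR_sum, ← sub_le_iff_le_add',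
    ← mul_sub, ← Finset.sum_sub_distrib]
  refine inv_card_mul_sum_le hne fun h hh => ?_
  rw [Finset.mem_Icc] at hh
  have hs := abs_logAvgR_shift_sub_le
    (fun n => (A (n - (q : ℤ) * (h : ℤ)) * (starRingEnd ℂ) (backAvg q H f n)).re) (fun n => by
      refine (Complex.abs_re_le_norm _).trans ?_
      rw [norm_mul, Complex.norm_conj]
      exact mul_le_one₀ (hA _) (norm_nonneg _) (norm_backAvg_le q H f hf n)) hN (q * h)
  have hm : 2 * (1 + Real.log ((q * h : ℕ) : ℝ)) / Real.log N ≤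
      2 * (1 + Real.log (q * H)) / Real.log N := by
    have : (0 : ℝ) < ((q * h : ℕ) : ℝ) := by exact_mod_cast Nat.mul_pos hq hh.1
    gcongr
    push_cast
    gcongr
    exact hh.2
  have e3 : ∀ n : ℤ, n + ((q * h : ℕ) : ℤ) - (q : ℤ) * (h : ℤ) = n := fun n => by
    push_cast
    ring
  simp only [e3] at hs
  linarith [(abs_le.1 hs).1]

theorem norm_sq_le_re_mul_conj_add {w z : ℂ} {δ : ℝ} (hz : ‖z‖ ≤ 1) (h : ‖w - z‖ ≤ δ) :
    ‖z‖ ^ 2 ≤ (w * (starRingEnd ℂ) z).re + δ := by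
  have e : (w * (starRingEnd ℂ) z).re = ‖z‖ ^ 2 + ((w - z) * (starRingEnd ℂ) z).re := by
    rw [sub_mul, Complex.sub_re, Complex.mul_conj' z]
    norm_cast
    ring
  have h1 := (abs_le.1 (Complex.abs_re_le_norm ((w - z) * (starRingEnd ℂ) z))).1
  rw [norm_mul, Complex.norm_conj] at h1
  have h2 : ‖w - z‖ * ‖z‖ ≤ ‖w - z‖ := mul_le_of_le_one_right (norm_nonneg _) hz
  linarith

theorem logAvgR_norm_sub_sq (s : Finset ℕ) (A B : ℕ → ℂ) :
    logAvgR s (fun n => ‖A n - B n‖ ^ 2) =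
      logAvgR s (fun n => ‖A n‖ ^ 2) + logAvgR s (fun n => ‖B n‖ ^ 2) -
        2 * logAvgR s (fun n => (A n * (starRingEnd ℂ) (B n)).re) := by
  have e : ∀ n, ‖A n - B n‖ ^ 2 =
      ‖A n‖ ^ 2 + ‖B n‖ ^ 2 + -2 * (A n * (starRingEnd ℂ) (B n)).re := fun n => by
    simp only [Complex.sq_norm, Complex.normSq_sub]
    ring
  simp only [e]
  rw [logAvgR_add, logAvgR_add, logAvgR_const_mul]
  ring

theorem logAvgR_norm_proj_sub_sq_le {N q d H H' : ℕ} (hN : 2 ≤ N) (hq : 0 < q) (hH : 0 < H)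
    (hH' : 0 < H') (f : ℤ → ℂ) (hf : ∀ n, ‖f n‖ ≤ 1) :
    logAvgR (Icc 1 N) (fun n => ‖proj (q * d) H' f (n : ℤ) - proj q H f (n : ℤ)‖ ^ 2) ≤
      logAvgR (Icc 1 N) (fun n => ‖proj (q * d) H' f (n : ℤ)‖ ^ 2) -
        logAvgR (Icc 1 N) (fun n => ‖proj q H f (n : ℤ)‖ ^ 2) +
        (8 * (1 + Real.log (q * H)) / Real.log N + 4 * (d * H') / H) := by
  have h1 := logAvgR_norm_proj_sq_le hN hq hH f hf
  have h2 := le_logAvgR_re_mul_conj_proj hN hq hH (proj (q * d) H' f) f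
    (norm_proj_le _ _ f hf) hf
  have h3 : logAvgR (Icc 1 N) (fun n => ‖backAvg q H f (n : ℤ)‖ ^ 2) ≤
      logAvgR (Icc 1 N) (fun n => (backAvg q H (proj (q * d) H' f) (n : ℤ) *
        (starRingEnd ℂ) (backAvg q H f (n : ℤ))).re) + 2 * (d * H') / H := by
    refine (logAvgR_mono fun n => norm_sq_le_re_mul_conj_add (norm_backAvg_le q H f hf n)
      (norm_backAvg_proj_sub_le q d H H' hH' f hf n)).trans ?_
    rw [logAvgR_add]
    gcongr
    exact logAvgR_const_le (by positivity)
  rw [logAvgR_norm_sub_sq]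
  have e1 : 8 * (1 + Real.log (q * H)) / Real.log N =
    4 * (2 * (1 + Real.log (q * H)) / Real.log N) := by ring
  have e2 : 4 * ((d : ℝ) * H') / H = 2 * (2 * (d * H') / H) := by ring
  rw [e1, e2]
  linarith

/-- Lemma 5.4 of the paper: approximate Pythagoras. -/
theorem proj_pythagoras :
    ∃ C : ℝ, 0 < C ∧
      ∀ (N q q' H H' : ℕ), 2 ≤ N → 0 < q → 0 < q' → 0 < H' →
        q ∣ q' → H' ≤ H →
        ∀ f : ℤ → ℂ, (∀ n, ‖f n‖ ≤ 1) →
          logAvgR (Finset.Icc 1 N)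
              (fun n => ‖proj q' H' f (n : ℤ) - proj q H f (n : ℤ)‖ ^ 2) ≤
            logAvgR (Finset.Icc 1 N) (fun n => ‖proj q' H' f (n : ℤ)‖ ^ 2) -
              logAvgR (Finset.Icc 1 N) (fun n => ‖proj q H f (n : ℤ)‖ ^ 2) +
              C * (Real.log ((q' : ℝ) * H) / Real.log N +
                    ((q' : ℝ) * H') / ((q : ℝ) * H)) := by
  refine ⟨20, by norm_num, ?_⟩
  intro N q q' H H' hN hq hq' hH' hdvd hle f hf
  obtain ⟨d, rfl⟩ := hdvd
  have hH : 0 < H := hH'.trans_le hle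
  have hd : 0 < d := Nat.pos_of_mul_pos_left hq'
  have hlogN : 0 < Real.log N := Real.log_pos (by exact_mod_cast hN)
  have hqR : (0 : ℝ) < q := by exact_mod_cast hq
  have hHR : (0 : ℝ) < H := by exact_mod_cast hH
  have hfrac : ((q * d : ℕ) : ℝ) * H' / (q * H) = d * H' / H := by
    push_cast
    field_simp
  rw [hfrac]
  by_cases h1 : q * d * H = 1
  · obtain ⟨h2, rfl⟩ := mul_eq_one.1 h1
    obtain ⟨rfl, rfl⟩ := mul_eq_one.1 h2
    obtain rfl : H' = 1 := by omega
    simp [logAvgR]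
  have hge : 2 ≤ q * d * H := by
    have := Nat.mul_pos hq' hH
    omega
  have hlog2 : Real.log 2 ≤ Real.log (((q * d : ℕ) : ℝ) * H) :=
    Real.log_le_log (by norm_num) (by exact_mod_cast hge)
  have hmono : Real.log ((q : ℝ) * H) ≤ Real.log (((q * d : ℕ) : ℝ) * H) := by
    apply Real.log_le_log (by positivity)
    gcongr
    exact Nat.le_mul_of_pos_right q hd
  have hl2 := Real.log_two_gt_d9
  have hnum : 8 * (1 + Real.log ((q : ℝ) * H)) ≤ 20 * Real.log (((q * d : ℕ) : ℝ) * H) := by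
    linarith
  have hfirst : 8 * (1 + Real.log ((q : ℝ) * H)) / Real.log N ≤
      20 * Real.log (((q * d : ℕ) : ℝ) * H) / Real.log N := by
    gcongr
  have hnonneg : (0 : ℝ) ≤ d * H' / H := by positivity
  have hmain := logAvgR_norm_proj_sub_sq_le (d := d) hN hq hH hH' f hf
  rw [mul_div_assoc 4] at hmain
  rw [mul_div_assoc 20] at hfirst
  linarith
end
end

section
/- There is an absolute constant c > 0 such that the following holds. Let N ≥ 2, let f, g : ℕ → ℂ be non-negative 1-bounded functions, let δ ∈ (0,1/2), and let H, q be positive integers with log(Hq)/log N < c·δ². Suppose 𝔼^log_{n∈[N]} f(n)·g(n) ≥ δ. Then 𝔼^log_{n∈[N]} (Π_{q,H}f)(n)·g(n) ≥ δ²/8. -/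
noncomputable section

open Finset

/-- Uniform average of a real-valued function over a finite set. -/
def avgR {α : Type*} (s : Finset α) (f : α → ℝ) : ℝ := (∑ x ∈ s, f x) / s.card

/-- Extension by zero of `f : ℕ → ℝ` to `ℤ`. -/
def ext0R (f : ℕ → ℝ) : ℤ → ℝ := fun m => if 0 ≤ m then f m.toNat else 0

/-- The averaging projection `Π_{q,H} f (n) = 𝔼_{h, h' ∈ [H]} f (n + q (h − h'))`,
real-valued version. -/
def projR (q H : ℕ) (f : ℤ → ℝ) (n : ℤ) : ℝ :=
  avgR (Finset.Icc 1 H) (fun h => avgR (Finset.Icc 1 H) (fun h' =>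
    f (n + (q : ℤ) * ((h : ℤ) - (h' : ℤ)))))

theorem sum_shift_le {T : ℕ → ℝ} {M N : ℕ} (hM : 1 ≤ M) (k : ℕ)
    (hT : ∀ n ∈ Icc 1 N, 0 ≤ T n) :
    ∑ m ∈ Icc M N, (if m + k ≤ N then T (m + k) else 0) ≤ ∑ n ∈ Icc 1 N, T n := by
  rw [← sum_filter, ← sum_image (f := T) (g := fun m => m + k) (fun a _ b _ h => by simpa using h)]
  refine sum_le_sum_of_subset_of_nonneg ?_ fun n hn _ => hT n hn
  intro n hn
  simp only [mem_image, mem_filter, mem_Icc] at hn ⊢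
  omega

theorem sum_sub_sum_le_sum_shift {T : ℕ → ℝ} {K M N k : ℕ} (hk : M + k ≤ K)
    (hT : ∀ n, 0 ≤ T n) :
    ∑ n ∈ Icc 1 N, T n - ∑ n ∈ Icc 1 K, T n ≤
      ∑ m ∈ Icc M N, (if m + k ≤ N then T (m + k) else 0) := by
  rw [← sum_filter, ← sum_image (f := T) (g := fun m => m + k) (fun a _ b _ h => by simpa using h),
    sub_le_iff_le_add', ← sum_union_inter]
  refine le_add_of_le_of_nonneg (sum_le_sum_of_subset_of_nonneg ?_ fun n _ _ => hT n)
    (sum_nonneg fun n _ => hT n)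
  intro n hn
  simp only [mem_union, mem_image, mem_filter, mem_Icc] at hn ⊢
  by_cases h : n ≤ K
  · exact Or.inl ⟨hn.1, h⟩
  · exact Or.inr ⟨n - k, by omega, by omega⟩

theorem projR_eq (q H : ℕ) (F : ℤ → ℝ) (n : ℤ) :
    projR q H F n =
      (∑ h' ∈ Icc 1 H, avgR (Icc 1 H) fun h => F (n - (q : ℤ) * h' + (q : ℤ) * h)) / H := by
  simp only [projR, avgR, Nat.card_Icc, Nat.add_sub_cancel]
  rw [← sum_div, ← sum_div, sum_comm]
  congr 2
  refine sum_congr rfl fun h' _ => sum_congr rfl fun h _ => ?_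
  congr 1
  ring

theorem ext0R_natCast (f : ℕ → ℝ) (n : ℕ) : ext0R f n = f n := by
  simp [ext0R]

theorem ext0R_nonneg {f : ℕ → ℝ} (hf : ∀ n, 0 ≤ f n) (m : ℤ) : 0 ≤ ext0R f m := by
  unfold ext0R
  split_ifs
  · exact hf _
  · exact le_rfl

theorem avgR_nonneg {α : Type*} {s : Finset α} {f : α → ℝ} (hf : ∀ x ∈ s, 0 ≤ f x) :
    0 ≤ avgR s f :=
  div_nonneg (sum_nonneg hf) (Nat.cast_nonneg _)

theorem avgR_mono {α : Type*} {s : Finset α} {f g : α → ℝ} (h : ∀ x ∈ s, f x ≤ g x) :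
    avgR s f ≤ avgR s g :=
  div_le_div_of_nonneg_right (sum_le_sum h) (Nat.cast_nonneg _)

theorem sum_one_div_eq_harmonic (n : ℕ) : ∑ k ∈ Icc 1 n, (1 : ℝ) / (k : ℝ) = (harmonic n : ℝ) := by
  rw [harmonic_eq_sum_Icc]
  simp

/-- The average of `F`, cut off at `N`, along `m + q, m + 2 * q, …, m + H * q`. -/
def truncAvg (N q H : ℕ) (F : ℕ → ℝ) (m : ℕ) : ℝ :=
  avgR (Icc 1 H) fun h => if m + q * h ≤ N then F (m + q * h) else 0

theorem truncAvg_nonneg {N q H : ℕ} {F : ℕ → ℝ} (hF : ∀ n, 0 ≤ F n) (m : ℕ) :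
    0 ≤ truncAvg N q H F m :=
  avgR_nonneg fun h _ => by
    split_ifs
    · exact hF _
    · exact le_rfl

theorem sum_truncAvg_sq_le {N q H : ℕ} (hH : 0 < H) (hq : 0 < q) {f g : ℕ → ℝ}
    (hf : ∀ n, 0 ≤ f n ∧ f n ≤ 1) (hg : ∀ n, 0 ≤ g n ∧ g n ≤ 1) :
    ∑ m ∈ Icc (H * q) N, truncAvg N q H (fun n => f n * g n) m ^ 2 / m ≤
      2 * ∑ n ∈ Icc 1 N, projR q H (ext0R f) (n : ℤ) * g n / n := by
  have hM : 1 ≤ H * q := Nat.mul_pos hH hq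
  set A : ℤ → ℝ := fun k => avgR (Icc 1 H) fun h => ext0R f (k + (q : ℤ) * h) with hA
  have hA0 : ∀ k, 0 ≤ A k := fun k => avgR_nonneg fun h _ => ext0R_nonneg (fun n => (hf n).1) _
  have hS : ∑ n ∈ Icc 1 N, projR q H (ext0R f) (n : ℤ) * g n / n =
      (∑ h' ∈ Icc 1 H, ∑ n ∈ Icc 1 N, A ((n : ℤ) - (q : ℤ) * h') * g n / n) / H := by
    rw [sum_comm, sum_div]
    refine sum_congr rfl fun n _ => ?_
    rw [projR_eq, ← sum_div, ← sum_mul]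
    ring
  have hshift : ∀ h' ∈ Icc 1 H,
      ∑ m ∈ Icc (H * q) N, (if m + q * h' ≤ N then A m * g (m + q * h') else 0) / m ≤
        2 * ∑ n ∈ Icc 1 N, A ((n : ℤ) - (q : ℤ) * h') * g n / n := by
    intro h' hh'
    refine le_trans ?_ (mul_le_mul_of_nonneg_left (sum_shift_le hM (q * h')
      (T := fun n => A ((n : ℤ) - (q : ℤ) * h') * g n / n)
      fun n _ => div_nonneg (mul_nonneg (hA0 _) (hg n).1) (Nat.cast_nonneg n)) zero_le_two)
    rw [mul_sum]
    refine sum_le_sum fun m hm => ?_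
    split_ifs
    · have hmM : H * q ≤ m := (mem_Icc.1 hm).1
      have hle : q * h' ≤ H * q := by
        rw [mul_comm]; exact Nat.mul_le_mul_right q (mem_Icc.1 hh').2
      have hm0 : (0 : ℝ) < m := by exact_mod_cast (by omega : 0 < m)
      have h2 : ((m + q * h' : ℕ) : ℝ) ≤ 2 * m := by exact_mod_cast (by omega)
      have hp : (0 : ℝ) < ((m + q * h' : ℕ) : ℝ) := by exact_mod_cast (by omega)
      have hcast : ((m + q * h' : ℕ) : ℤ) - (q : ℤ) * h' = m := by push_cast; ring
      simp only [hcast]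
      rw [← mul_div_assoc, div_le_div_iff₀ hm0 hp]
      have := mul_nonneg (hA0 m) (hg (m + q * h')).1
      nlinarith
    · simp
  have hu0 : ∀ m, 0 ≤ truncAvg N q H (fun n => f n * g n) m :=
    truncAvg_nonneg fun n => mul_nonneg (hf n).1 (hg n).1
  have huA : ∀ m : ℕ, truncAvg N q H (fun n => f n * g n) m ≤ A m := fun m =>
    avgR_mono fun h _ => by
      have hc : ext0R f ((m : ℤ) + (q : ℤ) * h) = f (m + q * h) := by
        rw [← ext0R_natCast f]; push_cast; rfl
      rw [hc]
      split_ifs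
      · exact mul_le_of_le_one_right (hf _).1 (hg _).2
      · exact (hf _).1
  have hug : ∀ m : ℕ, truncAvg N q H (fun n => f n * g n) m ≤ truncAvg N q H g m := fun m =>
    avgR_mono fun h _ => by
      split_ifs
      · exact mul_le_of_le_one_left (hg _).1 (hf _).2
      · exact le_rfl
  calc ∑ m ∈ Icc (H * q) N, truncAvg N q H (fun n => f n * g n) m ^ 2 / m
      ≤ ∑ m ∈ Icc (H * q) N, A m * truncAvg N q H g m / m := by
        refine sum_le_sum fun m _ => div_le_div_of_nonneg_right ?_ (Nat.cast_nonneg m)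
        rw [sq]
        exact mul_le_mul (huA m) (hug m) (hu0 m) (hA0 m)
    _ = (∑ h' ∈ Icc 1 H, ∑ m ∈ Icc (H * q) N,
          (if m + q * h' ≤ N then A m * g (m + q * h') else 0) / m) / H := by
        rw [sum_comm, sum_div]
        refine sum_congr rfl fun m _ => ?_
        simp only [truncAvg, avgR, Nat.card_Icc, Nat.add_sub_cancel]
        rw [← sum_div, mul_div_assoc', div_right_comm, mul_sum]
        simp only [mul_ite, mul_zero]
    _ ≤ (∑ h' ∈ Icc 1 H, 2 * ∑ n ∈ Icc 1 N, A ((n : ℤ) - (q : ℤ) * h') * g n / n) / H :=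
        div_le_div_of_nonneg_right (sum_le_sum hshift) (Nat.cast_nonneg H)
    _ = _ := by rw [hS, ← mul_sum, mul_div_assoc]

theorem sum_sub_harmonic_le_sum_truncAvg {N q H : ℕ} (hH : 0 < H) (hq : 0 < q) {F : ℕ → ℝ}
    (hF : ∀ n, 0 ≤ F n ∧ F n ≤ 1) :
    ∑ n ∈ Icc 1 N, F n / n - (harmonic (2 * (H * q)) : ℝ) ≤
      ∑ m ∈ Icc (H * q) N, truncAvg N q H F m / m := by
  have hM : 0 < H * q := Nat.mul_pos hH hq
  have hH' : (0 : ℝ) < H := by exact_mod_cast hH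
  have key : ∀ h ∈ Icc 1 H, ∑ n ∈ Icc 1 N, F n / n - (harmonic (2 * (H * q)) : ℝ) ≤
      ∑ m ∈ Icc (H * q) N, (if m + q * h ≤ N then F (m + q * h) else 0) / m := by
    intro h hh
    have hle : q * h ≤ H * q := by
      rw [mul_comm]; exact Nat.mul_le_mul_right q (mem_Icc.1 hh).2
    have h1 := sum_sub_sum_le_sum_shift (T := fun n => F n / n) (K := 2 * (H * q)) (M := H * q)
      (N := N) (k := q * h) (by omega) fun n => div_nonneg (hF n).1 (Nat.cast_nonneg n)
    have h2 : ∑ n ∈ Icc 1 (2 * (H * q)), F n / n ≤ (harmonic (2 * (H * q)) : ℝ) := by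
      rw [← sum_one_div_eq_harmonic]
      exact sum_le_sum fun n _ => div_le_div_of_nonneg_right (hF n).2 (Nat.cast_nonneg n)
    refine le_trans (le_trans (sub_le_sub_left h2 _) h1) (sum_le_sum fun m hm => ?_)
    have hm0 : (0 : ℝ) < m := by exact_mod_cast lt_of_lt_of_le hM (mem_Icc.1 hm).1
    split_ifs
    · refine div_le_div_of_nonneg_left (hF _).1 hm0 ?_
      exact_mod_cast Nat.le_add_right m _
    · simp
  calc _ ≤ (∑ h ∈ Icc 1 H, ∑ m ∈ Icc (H * q) N,
          (if m + q * h ≤ N then F (m + q * h) else 0) / m) / H := by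
        rw [le_div_iff₀ hH', mul_comm]
        simpa using card_nsmul_le_sum _ _ _ key
    _ = _ := by
        rw [sum_comm, sum_div]
        refine sum_congr rfl fun m _ => ?_
        simp only [truncAvg, avgR, Nat.card_Icc, Nat.add_sub_cancel]
        rw [← sum_div, div_right_comm]

theorem harmonic_two_mul_le {M : ℕ} (hM : 2 ≤ M) :
    (harmonic (2 * M) : ℝ) ≤ 4 * Real.log M := by
  have h1 := harmonic_le_one_add_log (2 * M)
  have hM0 : (M : ℝ) ≠ 0 := by positivity
  rw [Nat.cast_mul, Nat.cast_two, Real.log_mul two_ne_zero hM0] at h1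
  have h2 : Real.log 2 ≤ Real.log M := Real.log_le_log two_pos (by exact_mod_cast hM)
  have := Real.log_two_gt_d9
  linarith

/-- Lemma 5.5 of the paper: maximal function argument. -/
theorem proj_maximal :
    ∃ c : ℝ, 0 < c ∧
      ∀ (N H q : ℕ) (δ : ℝ) (f g : ℕ → ℝ),
        2 ≤ N → 0 < H → 0 < q → 0 < δ → δ < 1 / 2 →
        (∀ n, 0 ≤ f n ∧ f n ≤ 1) → (∀ n, 0 ≤ g n ∧ g n ≤ 1) →
        Real.log ((H : ℝ) * q) / Real.log N < c * δ ^ 2 →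
        δ ≤ logAvgR (Finset.Icc 1 N) (fun n => f n * g n) →
        δ ^ 2 / 8 ≤ logAvgR (Finset.Icc 1 N)
          (fun n => projR q H (ext0R f) (n : ℤ) * g n) := by
  refine ⟨1 / 8, by norm_num, ?_⟩
  intro N H q δ f g hN hH hq hδ hδ2 hf hg hlog havg
  rcases Nat.lt_or_ge (H * q) 2 with hlt | hM
  · have h1 : H * q = 1 := by have := Nat.mul_pos hH hq; omega
    obtain ⟨rfl, rfl⟩ : H = 1 ∧ q = 1 := by simpa using h1
    have hp : ∀ n : ℕ, projR 1 1 (ext0R f) (n : ℤ) = f n := fun n => by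
      simp [projR, avgR, ext0R_natCast]
    simp only [hp]
    nlinarith
  · have hlogN : 0 < Real.log N := Real.log_pos (by exact_mod_cast hN)
    have hNL : Real.log N ≤ harmonic N :=
      (Real.log_le_log (by positivity) (by push_cast; linarith)).trans (log_add_one_le_harmonic N)
    have hfg : ∀ n, 0 ≤ f n * g n ∧ f n * g n ≤ 1 := fun n =>
      ⟨mul_nonneg (hf n).1 (hg n).1, mul_le_one₀ (hf n).2 (hg n).1 (hg n).2⟩
    have hlow := sum_sub_harmonic_le_sum_truncAvg (N := N) hH hq hfg
    have hup := sum_truncAvg_sq_le (N := N) hH hq hf hg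
    have hharm := harmonic_two_mul_le hM
    rw [div_lt_iff₀ hlogN] at hlog
    unfold logAvgR at havg ⊢
    rw [sum_one_div_eq_harmonic] at havg ⊢
    set L : ℝ := (harmonic N : ℝ)
    have hL : 0 < L := hlogN.trans_le hNL
    rw [le_div_iff₀ hL] at havg ⊢
    have hcs : (∑ m ∈ Icc (H * q) N, truncAvg N q H (fun n => f n * g n) m / m) ^ 2 ≤
        (∑ m ∈ Icc (H * q) N, (1 : ℝ) / m) *
          ∑ m ∈ Icc (H * q) N, truncAvg N q H (fun n => f n * g n) m ^ 2 / m := by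
      refine sum_sq_le_sum_mul_sum_of_sq_le_mul _ (fun m _ => by positivity)
        (fun m _ => by positivity) fun m _ => le_of_eq (by ring)
    have hsub : ∑ m ∈ Icc (H * q) N, (1 : ℝ) / m ≤ L := by
      refine le_of_le_of_eq ?_ (sum_one_div_eq_harmonic N)
      exact sum_le_sum_of_subset_of_nonneg (Icc_subset_Icc_left (by omega))
        fun m _ _ => by positivity
    set U := ∑ m ∈ Icc (H * q) N, truncAvg N q H (fun n => f n * g n) m / m
    set V := ∑ m ∈ Icc (H * q) N, truncAvg N q H (fun n => f n * g n) m ^ 2 / m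
    have hV : 0 ≤ V := sum_nonneg fun m _ => by positivity
    push_cast at hharm
    have hsmall : (harmonic (2 * (H * q)) : ℝ) ≤ δ * L / 2 := by
      have : δ ^ 2 * Real.log N ≤ δ * L := by
        rw [sq, mul_assoc]
        refine mul_le_mul_of_nonneg_left ?_ hδ.le
        nlinarith
      linarith
    have hU : δ * L / 2 ≤ U := by linarith
    have hUV : U ^ 2 ≤ L * V := hcs.trans (mul_le_mul_of_nonneg_right hsub hV)
    have hsq : (δ * L / 2) ^ 2 ≤ L * V :=
      (pow_le_pow_left₀ (by positivity) hU 2).trans hUV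
    have hVlow : δ ^ 2 * L / 4 ≤ V := by
      refine le_of_mul_le_mul_left ?_ hL
      linarith
    linarith
end
end

section
/- There is an absolute constant C such that the following holds. Let N ≥ 2, let q, b be coprime positive integers, let H be a positive integer, and let f : ℕ → ℂ be 1-bounded. Then |𝔼^log_{n∈[N]} 𝔼_{h∈[H]} f(qn + bh) − 𝔼^log_{n∈[N]} f(n)| ≤ C·( (1 + log q + log(bH))/log N + q/H ). -/
noncomputable section

open Finset

/-- Logarithmic average of a complex-valued function over a finite set of naturals. -/
def logAvgC (s : Finset ℕ) (f : ℕ → ℂ) : ℂ :=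
  (∑ n ∈ s, f n / (n : ℂ)) / (∑ n ∈ s, (1 : ℂ) / (n : ℂ))

lemma sum_Icc_inv_eq_harmonic (n : ℕ) :
    ∑ i ∈ Icc 1 n, (i : ℝ)⁻¹ = (harmonic n : ℝ) := by
  simp [harmonic_eq_sum_Icc]

lemma harmonic_mono : Monotone (fun n => (harmonic n : ℝ)) := by
  intro m n h
  simp only [← sum_Icc_inv_eq_harmonic]
  exact sum_le_sum_of_subset_of_nonneg (Icc_subset_Icc_right h) fun i _ _ => by positivity

lemma sum_inv_mul_ite_eq_harmonic {n m : ℕ} (h : n ≤ m) :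
    ∑ i ∈ Icc 1 m, (i : ℝ)⁻¹ * (if i ≤ n then 1 else 0) = (harmonic n : ℝ) := by
  rw [← sum_Icc_inv_eq_harmonic]
  simp only [mul_ite, mul_one, mul_zero]
  rw [← sum_filter]
  congr 1
  ext i
  simp only [mem_filter, mem_Icc]
  omega

lemma abs_card_Icc_filter_modEq_sub_le {q : ℕ} (hq : 0 < q) (H v : ℕ) :
    |(#{h ∈ Icc 1 H | h ≡ v [MOD q]} : ℝ) - H / q| ≤ 1 := by
  have key := Nat.Ioc_filter_modEq_card 0 H hq v
  rw [show Ioc 0 H = Icc 1 H from rfl] at key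
  set c := #{h ∈ Icc 1 H | h ≡ v [MOD q]}
  have hd : ((H : ℚ) - v) / q = H / q + ((0 : ℕ) - v) / q := by
    rw [← add_div]
    push_cast
    ring
  have hnn : (0 : ℚ) ≤ H / q := by positivity
  have h1 := Int.floor_le (((H : ℚ) - v) / q)
  have h2 := Int.lt_floor_add_one (((H : ℚ) - v) / q)
  have h3 := Int.floor_le ((((0 : ℕ) : ℚ) - v) / q)
  have h4 := Int.lt_floor_add_one ((((0 : ℕ) : ℚ) - v) / q)
  have hle : ⌊(((0 : ℕ) : ℚ) - v) / q⌋ ≤ ⌊((H : ℚ) - v) / q⌋ := by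
    apply Int.floor_le_floor
    linarith
  rw [max_eq_left (by linarith)] at key
  have key' : (c : ℚ) = ⌊((H : ℚ) - v) / q⌋ - ⌊(((0 : ℕ) : ℚ) - v) / q⌋ := by exact_mod_cast key
  have hQ : |(c : ℚ) - H / q| ≤ 1 := by
    rw [abs_le]
    constructor <;> linarith
  have hR := (Rat.cast_le (K := ℝ)).mpr hQ
  push_cast at hR
  exact hR

lemma abs_card_filter_mul_modEq_sub_le {q b : ℕ} (hq : 0 < q) (hqb : q.Coprime b) (H m : ℕ) :
    |(#{h ∈ Icc 1 H | b * h ≡ m [MOD q]} : ℝ) - H / q| ≤ 1 := by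
  obtain ⟨u, hu⟩ : ∃ u, b * u ≡ 1 [MOD q] := by
    rcases Nat.lt_or_ge 1 q with h | h
    · obtain ⟨u, -, hu⟩ := Nat.exists_mul_mod_eq_one_of_coprime hqb.symm h
      exact ⟨u, by rw [Nat.ModEq, hu, Nat.mod_eq_of_lt h]⟩
    · obtain rfl : q = 1 := by omega
      exact ⟨0, Nat.modEq_one⟩
  have hv : b * (u * m) ≡ m [MOD q] := by simpa [mul_assoc] using hu.mul_right m
  have : ∀ h, b * h ≡ m [MOD q] ↔ h ≡ u * m [MOD q] := fun h =>
    ⟨fun hh => Nat.ModEq.cancel_left_of_coprime hqb (hh.trans hv.symm),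
      fun hh => (hh.mul_left b).trans hv⟩
  simp only [this]
  exact abs_card_Icc_filter_modEq_sub_le hq H _

/-- The number of representations `m = q * n + b * h` with `n ∈ [N]`, `h ∈ [H]`. -/
def reprCount (N q b H m : ℕ) : ℕ :=
  #{p ∈ Icc 1 N ×ˢ Icc 1 H | q * p.1 + b * p.2 = m}

lemma reprCount_le (N q b H m : ℕ) (hq : 0 < q) :
    reprCount N q b H m ≤ #{h ∈ Icc 1 H | b * h ≡ m [MOD q]} := by
  refine card_le_card_of_injOn Prod.snd ?_ ?_
  · rintro ⟨n, h⟩ hp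
    simp only [coe_filter, mem_product, Set.mem_ofPred_eq] at hp ⊢
    refine ⟨hp.1.2, ?_⟩
    rw [← hp.2]
    simp [Nat.ModEq]
  · rintro ⟨n, h⟩ hp ⟨n', h'⟩ hp' heq
    simp only [coe_filter, Set.mem_ofPred_eq] at hp hp' heq
    subst heq
    have : q * n = q * n' := by omega
    rw [Nat.eq_of_mul_eq_mul_left hq this]

lemma le_reprCount {N q b H m : ℕ} (hq : 0 < q) (hm : b * H < m) (hmN : m ≤ N) :
    #{h ∈ Icc 1 H | b * h ≡ m [MOD q]} ≤ reprCount N q b H m := by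
  refine card_le_card_of_injOn (fun h => ((m - b * h) / q, h)) ?_ ?_
  · intro h hh
    simp only [coe_filter, mem_product, mem_Icc, Set.mem_ofPred_eq] at hh ⊢
    obtain ⟨⟨h1, hH⟩, hmod⟩ := hh
    have hlt : b * h < m := (Nat.mul_le_mul_left b hH).trans_lt hm
    obtain ⟨k, hk⟩ := (Nat.modEq_iff_dvd' hlt.le).mp hmod
    rw [hk, Nat.mul_div_cancel_left k hq]
    have hk0 : 1 ≤ k := by
      rcases Nat.eq_zero_or_pos k with rfl | h0
      · omega
      · exact h0
    have hkm : k ≤ q * k := Nat.le_mul_of_pos_left k hq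
    exact ⟨⟨⟨hk0, by omega⟩, h1, hH⟩, by omega⟩
  · intro h _ h' _ heq
    exact (Prod.ext_iff.mp heq).2

lemma abs_reprCount_sub_le {N q b H m : ℕ} (hq : 0 < q) (hqb : q.Coprime b) (hH : 0 < H)
    (hqH : q ≤ H) :
    |(q : ℝ) / H * reprCount N q b H m - (if m ≤ N then 1 else 0)| ≤
      (q : ℝ) / H * (if m ≤ N then 1 else 0) + 2 * (if m ≤ b * H then 1 else 0) +
        2 * (1 - (if m ≤ N then 1 else 0)) := by
  have hq' : (0 : ℝ) < q := by exact_mod_cast hq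
  have hH' : (0 : ℝ) < H := by exact_mod_cast hH
  have hr : (q : ℝ) / H ≤ 1 := by
    rw [div_le_one hH']
    exact_mod_cast hqH
  have hr0 : (0 : ℝ) ≤ q / H := by positivity
  have hrr : (q : ℝ) / H * (H / q) = 1 := by field_simp
  have hc := abs_le.mp (abs_card_filter_mul_modEq_sub_le hq hqb H m)
  have hle : (reprCount N q b H m : ℝ) ≤ (#{h ∈ Icc 1 H | b * h ≡ m [MOD q]} : ℝ) := by
    exact_mod_cast reprCount_le N q b H m hq
  have hnn : (0 : ℝ) ≤ q / H * reprCount N q b H m := by positivity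
  have hub : (q : ℝ) / H * reprCount N q b H m ≤ 1 + q / H := by
    calc (q : ℝ) / H * reprCount N q b H m ≤ q / H * (H / q + 1) :=
          mul_le_mul_of_nonneg_left (by linarith) hr0
      _ = 1 + q / H := by rw [mul_add, hrr, mul_one]
  by_cases h1 : m ≤ N
  · by_cases h2 : m ≤ b * H
    · simp only [h1, h2, if_true]
      rw [abs_le]
      constructor <;> linarith
    · simp only [h1, h2, if_true, if_false]
      have hge : (#{h ∈ Icc 1 H | b * h ≡ m [MOD q]} : ℝ) ≤ (reprCount N q b H m : ℝ) := by
        exact_mod_cast le_reprCount hq (not_le.mp h2) h1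
      have hlb : 1 - (q : ℝ) / H ≤ q / H * reprCount N q b H m := by
        calc 1 - (q : ℝ) / H = q / H * (H / q - 1) := by rw [mul_sub, hrr, mul_one]
          _ ≤ _ := mul_le_mul_of_nonneg_left (by linarith) hr0
      rw [abs_le]
      constructor <;> linarith
  · simp only [h1, if_false]
    rw [abs_le]
    constructor <;> split_ifs <;> linarith

lemma sum_sum_eq_sum_reprCount (N q b H : ℕ) (hq : 0 < q) (g : ℕ → ℂ) :
    ∑ n ∈ Icc 1 N, ∑ h ∈ Icc 1 H, g (q * n + b * h) =
      ∑ m ∈ Icc 1 (q * N + b * H), (reprCount N q b H m : ℂ) * g m := by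
  rw [← sum_product', ← sum_fiberwise_of_maps_to (t := Icc 1 (q * N + b * H))
    (g := fun p : ℕ × ℕ => q * p.1 + b * p.2)]
  · refine sum_congr rfl fun m _ => ?_
    rw [sum_congr rfl (g := fun _ => g m) fun p hp => by rw [(mem_filter.mp hp).2]]
    rw [sum_const, nsmul_eq_mul, reprCount]
  · rintro ⟨n, h⟩ hp
    simp only [mem_product, mem_Icc] at hp ⊢
    have h1 := Nat.mul_le_mul_left q hp.1.2
    have h2 := Nat.mul_le_mul_left b hp.2.2
    have h3 : 0 < q * n := Nat.mul_pos hq hp.1.1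
    omega

lemma norm_sum_sum_sub_sum_le {N q b H : ℕ} (hq : 0 < q) (hqb : q.Coprime b)
    (hH : 0 < H) (hqH : q ≤ H) (g : ℕ → ℂ) (hg : ∀ n, ‖g n‖ ≤ (n : ℝ)⁻¹) :
    ‖(q / H : ℂ) * ∑ n ∈ Icc 1 N, ∑ h ∈ Icc 1 H, g (q * n + b * h) - ∑ n ∈ Icc 1 N, g n‖ ≤
      q / H * (harmonic N : ℝ) + 2 * (harmonic (b * H) : ℝ) +
        2 * ((harmonic (q * N + b * H) : ℝ) - (harmonic N : ℝ)) := by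
  have hNM : N ≤ q * N + b * H := (Nat.le_mul_of_pos_left N hq).trans (Nat.le_add_right _ _)
  have hKM : b * H ≤ q * N + b * H := Nat.le_add_left _ _
  have h0 : ∑ n ∈ Icc 1 N, g n =
      ∑ m ∈ Icc 1 (q * N + b * H), (if m ≤ N then 1 else 0 : ℝ) * g m := by
    have : Icc 1 N = {m ∈ Icc 1 (q * N + b * H) | m ≤ N} := by
      ext i
      simp only [mem_filter, mem_Icc]
      omega
    rw [this, sum_filter]
    refine sum_congr rfl fun m _ => ?_
    split_ifs <;> simp
  rw [sum_sum_eq_sum_reprCount N q b H hq, h0, mul_sum, ← sum_sub_distrib]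
  calc _ ≤ ∑ m ∈ Icc 1 (q * N + b * H), (m : ℝ)⁻¹ *
        ((q : ℝ) / H * (if m ≤ N then 1 else 0) + 2 * (if m ≤ b * H then 1 else 0) +
          2 * (1 - (if m ≤ N then 1 else 0))) := by
        refine norm_sum_le_of_le _ fun m _ => ?_
        have : (q / H : ℂ) * (reprCount N q b H m * g m) - (if m ≤ N then 1 else 0 : ℝ) * g m =
            g m * (((q : ℝ) / H * reprCount N q b H m - (if m ≤ N then 1 else 0) : ℝ) : ℂ) := by
          push_cast
          ring
        rw [this, norm_mul, Complex.norm_real, Real.norm_eq_abs]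
        exact mul_le_mul (hg m) (abs_reprCount_sub_le hq hqb hH hqH) (abs_nonneg _)
          (by positivity)
    _ = _ := by
        rw [← sum_inv_mul_ite_eq_harmonic hNM, ← sum_inv_mul_ite_eq_harmonic hKM,
          ← sum_Icc_inv_eq_harmonic (q * N + b * H), ← sum_sub_distrib, mul_sum, mul_sum, mul_sum,
          ← sum_add_distrib, ← sum_add_distrib]
        refine sum_congr rfl fun m _ => ?_
        ring

lemma sum_inv_add_eq_harmonic_sub (N K : ℕ) :
    ∑ n ∈ Icc 1 N, ((n : ℝ) + K)⁻¹ = (harmonic (N + K) : ℝ) - (harmonic K : ℝ) := by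
  induction N with
  | zero => simp
  | succ n ih =>
    rw [sum_Icc_succ_top (by omega), ih, Nat.add_right_comm, harmonic_succ]
    push_cast
    ring

lemma sum_inv_sub_inv_add_le_harmonic (N K : ℕ) :
    ∑ n ∈ Icc 1 N, ((n : ℝ)⁻¹ - ((n : ℝ) + K)⁻¹) ≤ (harmonic K : ℝ) := by
  rw [sum_sub_distrib, sum_Icc_inv_eq_harmonic, sum_inv_add_eq_harmonic_sub]
  have : (harmonic N : ℝ) ≤ (harmonic (N + K) : ℝ) := harmonic_mono (Nat.le_add_right N K)
  linarith

lemma norm_sum_avgC_div_sub_le {N q b H : ℕ} (hq : 0 < q) (hH : 0 < H)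
    (f : ℕ → ℂ) (hf : ∀ n, ‖f n‖ ≤ 1) :
    ‖∑ n ∈ Icc 1 N, avgC (Icc 1 H) (fun h => f (q * n + b * h)) / (n : ℂ) -
      (q / H : ℂ) * ∑ n ∈ Icc 1 N, ∑ h ∈ Icc 1 H,
        f (q * n + b * h) / ((q * n + b * h : ℕ) : ℂ)‖ ≤ (harmonic (b * H) : ℝ) := by
  have hq' : (1 : ℝ) ≤ q := by exact_mod_cast hq
  have hH' : (0 : ℝ) < H := by exact_mod_cast hH
  rw [mul_sum, ← sum_sub_distrib]
  refine (norm_sum_le_of_le _ fun n hn => ?_).trans (sum_inv_sub_inv_add_le_harmonic N (b * H))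
  have hn' : (0 : ℝ) < n := by exact_mod_cast (mem_Icc.mp hn).1
  have heq : avgC (Icc 1 H) (fun h => f (q * n + b * h)) / (n : ℂ) -
      (q / H : ℂ) * ∑ h ∈ Icc 1 H, f (q * n + b * h) / ((q * n + b * h : ℕ) : ℂ) =
      (H : ℂ)⁻¹ * ∑ h ∈ Icc 1 H,
        f (q * n + b * h) * (((n : ℝ)⁻¹ - q / ((q * n + b * h : ℕ) : ℝ) : ℝ) : ℂ) := by
    rw [avgC, Nat.card_Icc, Nat.add_sub_cancel, sum_div, sum_div, mul_sum, mul_sum,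
      ← sum_sub_distrib]
    refine sum_congr rfl fun h _ => ?_
    push_cast
    ring
  rw [heq, norm_mul, norm_inv, Complex.norm_natCast, inv_mul_le_iff₀ hH']
  refine (norm_sum_le_of_le _ (n := fun _ => (n : ℝ)⁻¹ - ((n : ℝ) + ((b * H : ℕ) : ℝ))⁻¹)
    fun h hh => ?_).trans ?_
  · have hbh : (b : ℝ) * h ≤ b * H := by
      exact_mod_cast Nat.mul_le_mul_left b (mem_Icc.mp hh).2
    have hbh0 : (0 : ℝ) ≤ b * h := by positivity
    rw [norm_mul, Complex.norm_real, Real.norm_eq_abs]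
    push_cast
    have hpos : (0 : ℝ) < q * n + b * h := by positivity
    have h1 : (q : ℝ) / (q * n + b * h) ≤ (n : ℝ)⁻¹ := by
      rw [div_le_iff₀ hpos, inv_mul_eq_div, le_div_iff₀ hn']
      linarith
    have h2 : ((n : ℝ) + b * H)⁻¹ ≤ q / (q * n + b * h) := by
      rw [inv_eq_one_div, div_le_div_iff₀ (by positivity) hpos]
      nlinarith
    rw [abs_of_nonneg (by linarith)]
    calc _ ≤ 1 * ((n : ℝ)⁻¹ - q / (q * n + b * h)) :=
          mul_le_mul_of_nonneg_right (hf _) (by linarith)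
      _ ≤ _ := by linarith
  · rw [sum_const, Nat.card_Icc, Nat.add_sub_cancel, nsmul_eq_mul]

lemma norm_avgC_le_one {α : Type*} (s : Finset α) (f : α → ℂ) (hf : ∀ x, ‖f x‖ ≤ 1) :
    ‖avgC s f‖ ≤ 1 := by
  rw [avgC, norm_div, Complex.norm_natCast]
  refine div_le_one_of_le₀ ?_ (by positivity)
  simpa using norm_sum_le_of_le s fun x _ => hf x

lemma logAvgC_Icc_eq (N : ℕ) (f : ℕ → ℂ) :
    logAvgC (Icc 1 N) f = (∑ n ∈ Icc 1 N, f n / (n : ℂ)) / ((harmonic N : ℝ) : ℂ) := by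
  rw [logAvgC, ← sum_Icc_inv_eq_harmonic]
  simp

lemma norm_logAvgC_Icc_le_one (N : ℕ) (f : ℕ → ℂ) (hf : ∀ n, ‖f n‖ ≤ 1) :
    ‖logAvgC (Icc 1 N) f‖ ≤ 1 := by
  have h0 : (0 : ℝ) ≤ (harmonic N : ℝ) := by simpa using harmonic_mono (Nat.zero_le N)
  rw [logAvgC_Icc_eq, norm_div, Complex.norm_real, Real.norm_of_nonneg h0]
  refine div_le_one_of_le₀ ?_ h0
  rw [← sum_Icc_inv_eq_harmonic]
  refine norm_sum_le_of_le _ fun n _ => ?_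
  rw [norm_div, Complex.norm_natCast, ← one_div]
  exact div_le_div_of_nonneg_right (hf n) (by positivity)

lemma harmonic_mul_add_sub_harmonic_le {N q K : ℕ} (hN : 0 < N) (hq : 0 < q) (hK : 0 < K) :
    (harmonic (q * N + K) : ℝ) - (harmonic N : ℝ) ≤ 2 + Real.log q + Real.log K := by
  have hN' : (1 : ℝ) ≤ N := by exact_mod_cast hN
  have hq' : (1 : ℝ) ≤ q := by exact_mod_cast hq
  have hK' : (1 : ℝ) ≤ K := by exact_mod_cast hK
  have h1 := harmonic_le_one_add_log (q * N + K)
  have h2 : Real.log N ≤ (harmonic N : ℝ) :=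
    (Real.log_le_log (by positivity) (by push_cast; linarith)).trans (log_add_one_le_harmonic N)
  have h3 : Real.log ((q * N + K : ℕ) : ℝ) ≤ Real.log (2 * q * K * N) := by
    apply Real.log_le_log
    · positivity
    · push_cast
      have ha : (q : ℝ) * N ≤ q * N * K := le_mul_of_one_le_right (by positivity) hK'
      have hc : (1 : ℝ) * K ≤ q * N * K :=
        mul_le_mul_of_nonneg_right (one_le_mul_of_one_le_of_one_le hq' hN') (by positivity)
      linarith
  rw [Real.log_mul (by positivity) (by positivity), Real.log_mul (by positivity) (by positivity),
    Real.log_mul (by positivity) (by positivity)] at h3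
  have h4 := Real.log_two_lt_d9
  linarith

/-- Lemma A.3 of the paper. -/
theorem frobenius_coin_average :
    ∃ C : ℝ, 0 < C ∧
      ∀ (N q b H : ℕ) (f : ℕ → ℂ),
        2 ≤ N → 0 < q → 0 < b → Nat.Coprime q b → 0 < H →
        (∀ n, ‖f n‖ ≤ 1) →
        ‖logAvgC (Finset.Icc 1 N) (fun n =>
              avgC (Finset.Icc 1 H) (fun h => f (q * n + b * h))) -
            logAvgC (Finset.Icc 1 N) f‖ ≤
          C * ((1 + Real.log q + Real.log ((b : ℝ) * H)) / Real.log N +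
                (q : ℝ) / H) := by
  refine ⟨7, by norm_num, fun N q b H f hN hq hb hqb hH hf => ?_⟩
  have hq' : (1 : ℝ) ≤ q := by exact_mod_cast hq
  have hH' : (0 : ℝ) < H := by exact_mod_cast hH
  have hK : 0 < b * H := Nat.mul_pos hb hH
  have hlogN : 0 < Real.log N := Real.log_pos (by exact_mod_cast hN)
  have hlogq : 0 ≤ Real.log q := Real.log_natCast_nonneg q
  have hlogK : 0 ≤ Real.log ((b : ℝ) * H) := by exact_mod_cast Real.log_natCast_nonneg (b * H)
  rcases lt_or_ge H q with hHq | hqH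
  · have h1 : 1 ≤ (q : ℝ) / H := by
      rw [one_le_div hH']
      exact_mod_cast hHq.le
    have h2 : 0 ≤ (1 + Real.log q + Real.log ((b : ℝ) * H)) / Real.log N := by positivity
    have h3 := norm_sub_le
      (logAvgC (Icc 1 N) fun n => avgC (Icc 1 H) fun h => f (q * n + b * h)) (logAvgC (Icc 1 N) f)
    have h4 := norm_logAvgC_Icc_le_one N (fun n => avgC (Icc 1 H) fun h => f (q * n + b * h))
      fun n => norm_avgC_le_one _ _ fun h => hf _
    have h5 := norm_logAvgC_Icc_le_one N f hf
    linarith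
  · have hL : Real.log N ≤ (harmonic N : ℝ) :=
      (Real.log_le_log (by positivity) (by push_cast; linarith)).trans (log_add_one_le_harmonic N)
    have hL0 : 0 < (harmonic N : ℝ) := hlogN.trans_le hL
    have hA := norm_sum_avgC_div_sub_le (N := N) (b := b) hq hH f hf
    have hB := norm_sum_sum_sub_sum_le (N := N) hq hqb hH hqH (fun n => f n / (n : ℂ))
      fun n => by
        rw [norm_div, Complex.norm_natCast, ← one_div]
        exact div_le_div_of_nonneg_right (hf n) (by positivity)
    have hC := harmonic_mul_add_sub_harmonic_le (N := N) (by omega) hq hK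
    have hD := harmonic_le_one_add_log (b * H)
    push_cast at hC hD
    rw [logAvgC_Icc_eq, logAvgC_Icc_eq, ← sub_div, norm_div, Complex.norm_real,
      Real.norm_of_nonneg hL0.le, div_le_iff₀ hL0]
    have hE : 1 + Real.log q + Real.log ((b : ℝ) * H) ≤
        (1 + Real.log q + Real.log ((b : ℝ) * H)) / Real.log N * (harmonic N : ℝ) := by
      rw [div_mul_eq_mul_div, le_div_iff₀ hlogN]
      exact mul_le_mul_of_nonneg_left hL (by positivity)
    have hF : 0 ≤ (q : ℝ) / H * (harmonic N : ℝ) := by positivity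
    refine (norm_sub_le_norm_sub_add_norm_sub _ _ _).trans ((add_le_add hA hB).trans ?_)
    linarith
end
end

section
/- There is an absolute constant C such that the following holds. Let N ≥ 2, let f : ℕ → ℂ be 1-bounded, and let q ∈ ℕ with q ≥ 2. Then |𝔼^log_{n∈[N]}( f(n) − q·𝟏_{q|n}·f(n/q) )| ≤ C·log q / log N, where 𝟏_{q|n} is 1 if q divides n and 0 otherwise. -/
noncomputable section

open Finset

theorem sum_Icc_one_div_eq_harmonic (n : ℕ) :
    ∑ k ∈ Icc 1 n, (1 : ℝ) / k = (harmonic n : ℝ) := by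
  rw [harmonic_eq_sum_Icc]
  push_cast
  simp only [one_div]

/-- Only multiples of `q` contribute to the dilated sum, which therefore is a shorter sum. -/
theorem sum_dilation_div (N q : ℕ) (hq : 0 < q) (f : ℕ → ℂ) :
    ∑ n ∈ Icc 1 N, (if q ∣ n then (q : ℂ) * f (n / q) else 0) / (n : ℂ) =
      ∑ m ∈ Icc 1 (N / q), f m / (m : ℂ) := by
  have hq0 : (q : ℂ) ≠ 0 := by exact_mod_cast hq.ne'
  simp only [ite_div, zero_div]
  rw [← sum_filter]
  symm
  refine sum_bij (fun m _ => q * m) ?_ ?_ ?_ ?_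
  · intro m hm
    rw [mem_Icc] at hm
    rw [mem_filter, mem_Icc]
    refine ⟨⟨Nat.mul_pos hq hm.1, ?_⟩, dvd_mul_right q m⟩
    rw [mul_comm]
    exact (Nat.le_div_iff_mul_le hq).1 hm.2
  · intro a _ b _ h
    exact Nat.eq_of_mul_eq_mul_left hq h
  · intro n hn
    rw [mem_filter, mem_Icc] at hn
    obtain ⟨⟨h1, h2⟩, m, rfl⟩ := hn
    refine ⟨m, mem_Icc.2 ⟨Nat.pos_of_mul_pos_left h1, ?_⟩, rfl⟩
    rw [Nat.le_div_iff_mul_le hq, mul_comm]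
    exact h2
  · intro m _
    rw [Nat.mul_div_cancel_left m hq]
    push_cast
    rw [mul_div_mul_left _ _ hq0]

theorem norm_sum_Icc_sub_le_harmonic_sub {M N : ℕ} (h : M ≤ N) (f : ℕ → ℂ)
    (hf : ∀ n, ‖f n‖ ≤ 1) :
    ‖∑ n ∈ Icc 1 N, f n / (n : ℂ) - ∑ n ∈ Icc 1 M, f n / (n : ℂ)‖ ≤
      (harmonic N : ℝ) - (harmonic M : ℝ) := by
  have hsub : Icc 1 M ⊆ Icc 1 N := Icc_subset_Icc_right h
  rw [← sum_Icc_one_div_eq_harmonic, ← sum_Icc_one_div_eq_harmonic,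
    ← sum_sdiff_eq_sub hsub, ← sum_sdiff_eq_sub hsub]
  refine norm_sum_le_of_le _ fun n _ => ?_
  rw [norm_div, Complex.norm_natCast]
  gcongr
  exact hf n

theorem harmonic_sub_harmonic_div_le (N q : ℕ) (hN : 0 < N) (hq : 0 < q) :
    (harmonic N : ℝ) - (harmonic (N / q) : ℝ) ≤ 1 + Real.log q := by
  have hN' : (0 : ℝ) < N := by exact_mod_cast hN
  have hq' : (0 : ℝ) < q := by exact_mod_cast hq
  have hlt : (N : ℝ) / q ≤ ((N / q + 1 : ℕ) : ℝ) := by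
    rw [div_le_iff₀ hq']
    exact_mod_cast (Nat.lt_mul_of_div_lt (Nat.lt_succ_self _) hq).le
  have h1 := Real.log_le_log (div_pos hN' hq') hlt
  rw [Real.log_div hN'.ne' hq'.ne'] at h1
  linarith [harmonic_le_one_add_log N, log_add_one_le_harmonic (N / q)]

/-- Lemma A.4 of the paper: logarithmic averages under dilation. -/
theorem log_average_dilation :
    ∃ C : ℝ, 0 < C ∧
      ∀ (N q : ℕ) (f : ℕ → ℂ),
        2 ≤ N → 2 ≤ q → (∀ n, ‖f n‖ ≤ 1) →
        ‖logAvgC (Finset.Icc 1 N)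
            (fun n => f n - (if q ∣ n then (q : ℂ) * f (n / q) else 0))‖ ≤
          C * Real.log q / Real.log N := by
  refine ⟨3, by norm_num, fun N q f hN hq hf => ?_⟩
  have hq0 : 0 < q := by omega
  have hN1 : (1 : ℝ) < N := by exact_mod_cast hN
  have hlogN : 0 < Real.log N := Real.log_pos hN1
  have hlogq : Real.log 2 ≤ Real.log q :=
    Real.log_le_log (by norm_num) (by exact_mod_cast hq)
  have hden : Real.log N ≤ (harmonic N : ℝ) :=
    (Real.log_le_log (by linarith) (by push_cast; linarith)).trans
      (log_add_one_le_harmonic N)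
  have hcast : ∑ n ∈ Icc 1 N, (1 : ℂ) / (n : ℂ) = ((harmonic N : ℝ) : ℂ) := by
    rw [← sum_Icc_one_div_eq_harmonic]
    push_cast
    rfl
  have hnum := (norm_sum_Icc_sub_le_harmonic_sub (Nat.div_le_self N q) f hf).trans
    (harmonic_sub_harmonic_div_le N q (by omega) hq0)
  simp only [logAvgC, sub_div, sum_sub_distrib]
  rw [← sub_div, sum_dilation_div N q hq0 f, hcast, norm_div, Complex.norm_real,
    Real.norm_of_nonneg (hlogN.le.trans hden)]
  exact div_le_div₀ (by linarith [Real.log_two_gt_d9])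
    (by linarith [Real.log_two_gt_d9]) hlogN hden
end
end

section
/- There is an absolute constant C such that the following holds (logarithmic Elliott inequality). Let N ≥ 2, let 𝒫 be a nonempty finite set of primes all bounded by P, and let f : ℕ → ℂ be 1-bounded. Then |𝔼^log_{n∈[N]} f(n) − 𝔼^log_{n∈[N], p∈𝒫} f(pn)| ≤ C·( log P / log N + (Σ_{p∈𝒫} 1/p)^{−1/2} ). -/
noncomputable section

open Finset

/-- Elementary bounds for the partial sums of the harmonic series. -/
lemma sum_Icc_one_div_bounds {x : ℝ} (hx : 1 ≤ x) :
    Real.log x ≤ ∑ k ∈ Icc 1 ⌊x⌋₊, (1 : ℝ) / k ∧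
      ∑ k ∈ Icc 1 ⌊x⌋₊, (1 : ℝ) / k ≤ 1 + Real.log x := by
  have h : ∑ k ∈ Icc 1 ⌊x⌋₊, (1 : ℝ) / k = ((harmonic ⌊x⌋₊ : ℚ) : ℝ) := by
    rw [harmonic_eq_sum_Icc]; push_cast; simp
  rw [h]
  exact ⟨log_le_harmonic_floor x (by linarith), harmonic_floor_le_one_add_log x hx⟩

lemma sum_Icc_filter_dvd {E : Type*} [AddCommMonoid E] (N d : ℕ) (hd : 0 < d) (g : ℕ → E) :
    ∑ m ∈ Icc 1 N with d ∣ m, g m = ∑ n ∈ Icc 1 (N / d), g (d * n) := by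
  symm
  refine sum_bij (fun n _ => d * n) ?_ ?_ ?_ (fun _ _ => rfl)
  · intro n hn
    simp only [mem_Icc, mem_filter] at hn ⊢
    refine ⟨⟨Nat.mul_pos hd hn.1, ?_⟩, dvd_mul_right _ _⟩
    rw [mul_comm]
    exact (Nat.le_div_iff_mul_le hd).1 hn.2
  · intro a _ b _ h
    exact Nat.eq_of_mul_eq_mul_left hd h
  · intro m hm
    simp only [mem_Icc, mem_filter] at hm
    obtain ⟨⟨h1, h2⟩, k, rfl⟩ := hm
    refine ⟨k, ?_, rfl⟩
    simp only [mem_Icc]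
    refine ⟨Nat.pos_of_mul_pos_left h1, (Nat.le_div_iff_mul_le hd).2 ?_⟩
    rwa [mul_comm]

/-- Logarithmic count of the multiples of `d` up to `N`. -/
lemma sum_multiples_one_div_bounds {N d : ℕ} (hd : 0 < d) (hdN : d ≤ N) :
    (Real.log N - Real.log d) / d ≤ ∑ m ∈ Icc 1 N with d ∣ m, (1 : ℝ) / m ∧
      ∑ m ∈ Icc 1 N with d ∣ m, (1 : ℝ) / m ≤ (1 + Real.log N - Real.log d) / d := by
  have hd' : (0 : ℝ) < d := by exact_mod_cast hd
  have hN' : (0 : ℝ) < N := by exact_mod_cast hd.trans_le hdN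
  have hx : (1 : ℝ) ≤ (N : ℝ) / d := by
    rw [le_div_iff₀ hd', one_mul]; exact_mod_cast hdN
  have hS : ∑ m ∈ Icc 1 N with d ∣ m, (1 : ℝ) / m =
      (∑ k ∈ Icc 1 ⌊(N : ℝ) / d⌋₊, (1 : ℝ) / k) / d := by
    rw [sum_Icc_filter_dvd N d hd, Nat.floor_div_eq_div, sum_div]
    refine sum_congr rfl fun n _ => ?_
    push_cast
    rw [div_div, mul_comm]
  obtain ⟨h1, h2⟩ := sum_Icc_one_div_bounds hx
  rw [Real.log_div hN'.ne' hd'.ne'] at h1 h2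
  rw [hS]
  constructor <;> gcongr
  linarith

lemma norm_logAvgC_le_one (s : Finset ℕ) {f : ℕ → ℂ} (hf : ∀ n, ‖f n‖ ≤ 1) :
    ‖logAvgC s f‖ ≤ 1 := by
  have h : ‖∑ n ∈ s, (1 : ℂ) / (n : ℂ)‖ = ∑ n ∈ s, (1 : ℝ) / n := by
    have : ∑ n ∈ s, (1 : ℂ) / (n : ℂ) = ((∑ n ∈ s, (1 : ℝ) / n : ℝ) : ℂ) := by push_cast; rfl
    rw [this, Complex.norm_real, Real.norm_of_nonneg (by positivity)]
  rw [logAvgC, norm_div, h]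
  refine div_le_one_of_le₀ ((norm_sum_le _ _).trans (sum_le_sum fun n _ => ?_)) (by positivity)
  rw [norm_div, Complex.norm_natCast]
  gcongr
  exact hf n

/-- Logarithmic Turán–Kubilius inequality. -/
lemma log_turan_kubilius {N : ℕ} {Ps : Finset ℕ} (hP : ∀ p ∈ Ps, Nat.Prime p)
    (hN : ∀ p ∈ Ps, ∀ q ∈ Ps, p * q ≤ N) (hN1 : 1 ≤ N) :
    ∑ m ∈ Icc 1 N, (1 : ℝ) / m * ((∑ p ∈ Ps, if p ∣ m then (1 : ℝ) else 0) -
        ∑ p ∈ Ps, (1 : ℝ) / p) ^ 2 ≤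
      2 * (∑ p ∈ Ps, (1 : ℝ) / p) ^ 2 +
        (∑ p ∈ Ps, (1 : ℝ) / p) * ∑ m ∈ Icc 1 N, (1 : ℝ) / m := by
  set A := ∑ p ∈ Ps, (1 : ℝ) / p with hA
  set H := ∑ m ∈ Icc 1 N, (1 : ℝ) / m with hH
  set L := Real.log N
  set B := ∑ p ∈ Ps, Real.log p / p with hB
  have hA0 : 0 ≤ A := by positivity
  have hHL : H ≤ 1 + L := by
    have := (sum_Icc_one_div_bounds (x := N) (by exact_mod_cast hN1)).2
    rwa [Nat.floor_natCast] at this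
  have hpN : ∀ p ∈ Ps, p ≤ N := fun p hp => (Nat.le_mul_self p).trans (hN p hp p hp)
  have hfirst : L * A - B ≤ ∑ p ∈ Ps, ∑ m ∈ Icc 1 N with p ∣ m, (1 : ℝ) / m := by
    rw [hA, hB, mul_sum, ← sum_sub_distrib]
    refine sum_le_sum fun p hp => ?_
    refine le_trans (le_of_eq ?_)
      (sum_multiples_one_div_bounds (hP p hp).pos (hpN p hp)).1
    ring
  have hpair : ∀ p ∈ Ps, ∀ q ∈ Ps, ∑ m ∈ Icc 1 N with p ∣ m ∧ q ∣ m, (1 : ℝ) / m ≤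
      (1 + L) * (1 / p * (1 / q)) - Real.log p / p * (1 / q) - 1 / p * (Real.log q / q) +
        if p = q then 1 / p * H else 0 := by
    intro p hp q hq
    have hp0 : (0 : ℝ) < p := by exact_mod_cast (hP p hp).pos
    have hq0 : (0 : ℝ) < q := by exact_mod_cast (hP q hq).pos
    have hb := sum_multiples_one_div_bounds (Nat.mul_pos (hP p hp).pos (hP q hq).pos)
      (hN p hp q hq)
    have he : (1 + L) * (1 / p * (1 / q)) - Real.log p / p * (1 / q) -
        1 / p * (Real.log q / q) = (1 + L - Real.log ((p * q : ℕ) : ℝ)) / ((p * q : ℕ) : ℝ) := by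
      push_cast
      rw [Real.log_mul hp0.ne' hq0.ne']
      field_simp
      ring
    rw [he]
    split_ifs with h
    · subst h
      have h0 := hb.2
      have h00 : 0 ≤ ∑ m ∈ Icc 1 N with p * p ∣ m, (1 : ℝ) / m := by positivity
      have h1 : ∑ m ∈ Icc 1 N with p ∣ m ∧ p ∣ m, (1 : ℝ) / m ≤ 1 / p * H := by
        simp only [and_self]
        rw [sum_Icc_filter_dvd N p (hP p hp).pos, hH, mul_sum]
        refine le_trans (le_of_eq ?_) (sum_le_sum_of_subset_of_nonneg
          (Icc_subset_Icc_right (Nat.div_le_self N p)) (fun i _ _ => by positivity))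
        refine sum_congr rfl fun n _ => ?_
        push_cast
        rw [div_mul_div_comm, one_mul]
      linarith
    · rw [add_zero]
      refine le_trans (le_of_eq ?_) hb.2
      refine sum_congr (filter_congr fun m _ => ?_) fun _ _ => rfl
      have hc := (Nat.coprime_primes (hP p hp) (hP q hq)).2 h
      exact ⟨fun h => hc.mul_dvd_of_dvd_of_dvd h.1 h.2,
        fun h => ⟨(dvd_mul_right p q).trans h, (dvd_mul_left q p).trans h⟩⟩
  have hsecond : ∑ p ∈ Ps, ∑ q ∈ Ps, ∑ m ∈ Icc 1 N with p ∣ m ∧ q ∣ m, (1 : ℝ) / m ≤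
      (1 + L) * A ^ 2 - 2 * A * B + A * H := by
    refine (sum_le_sum fun p hp => sum_le_sum fun q hq => hpair p hp q hq).trans (le_of_eq ?_)
    simp only [sum_add_distrib, sum_sub_distrib, ← mul_sum, ← sum_mul, sum_ite_eq]
    rw [← hA, ← hB, sum_congr rfl (fun p hp => if_pos hp), ← sum_mul, ← hA]
    ring
  have hexp : ∑ m ∈ Icc 1 N, (1 : ℝ) / m * ((∑ p ∈ Ps, if p ∣ m then (1 : ℝ) else 0) - A) ^ 2 =
      ∑ p ∈ Ps, ∑ q ∈ Ps, ∑ m ∈ Icc 1 N with p ∣ m ∧ q ∣ m, (1 : ℝ) / m -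
        2 * A * ∑ p ∈ Ps, ∑ m ∈ Icc 1 N with p ∣ m, (1 : ℝ) / m + A ^ 2 * H := by
    have e1 : ∑ p ∈ Ps, ∑ m ∈ Icc 1 N with p ∣ m, (1 : ℝ) / m =
        ∑ m ∈ Icc 1 N, (1 : ℝ) / m * ∑ p ∈ Ps, if p ∣ m then (1 : ℝ) else 0 := by
      simp only [sum_filter, mul_sum]
      rw [sum_comm]
      simp
    have e2 : ∑ p ∈ Ps, ∑ q ∈ Ps, ∑ m ∈ Icc 1 N with p ∣ m ∧ q ∣ m, (1 : ℝ) / m =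
        ∑ m ∈ Icc 1 N, (1 : ℝ) / m * (∑ p ∈ Ps, if p ∣ m then (1 : ℝ) else 0) ^ 2 := by
      simp only [sum_filter, sq, sum_mul_sum]
      rw [sum_congr rfl fun p _ => sum_comm, sum_comm]
      refine sum_congr rfl fun m _ => ?_
      rw [mul_sum]
      refine sum_congr rfl fun p _ => ?_
      rw [mul_sum]
      refine sum_congr rfl fun q _ => ?_
      by_cases hp : p ∣ m <;> by_cases hq : q ∣ m <;> simp [hp, hq]
    rw [e1, e2, hH, mul_sum _ _ (2 * A), mul_sum _ _ (A ^ 2), ← sum_sub_distrib, ← sum_add_distrib]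
    refine sum_congr rfl fun m _ => ?_
    ring
  rw [hexp]
  nlinarith [mul_le_mul_of_nonneg_left hfirst hA0, mul_le_mul_of_nonneg_left hHL (sq_nonneg A)]

/-- Logarithmic averages of `f` and of its dilates, before normalisation. -/
lemma norm_sum_sub_sum_dilate_le {N : ℕ} {P : ℝ} {Ps : Finset ℕ} {f : ℕ → ℂ}
    (hPs : ∀ p ∈ Ps, Nat.Prime p ∧ (p : ℝ) ≤ P) (hN : ∀ p ∈ Ps, p ≤ N) (hN1 : 1 ≤ N)
    (hf : ∀ n, ‖f n‖ ≤ 1) :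
    ‖∑ m ∈ Icc 1 N, f m / m * (∑ p ∈ Ps, if p ∣ m then (1 : ℂ) else 0) -
        ∑ p ∈ Ps, ∑ n ∈ Icc 1 N, f (p * n) / ((p * n : ℕ) : ℂ)‖ ≤
      (∑ p ∈ Ps, (1 : ℝ) / p) * (1 + Real.log P) := by
  have e1 : ∑ m ∈ Icc 1 N, f m / m * (∑ p ∈ Ps, if p ∣ m then (1 : ℂ) else 0) =
      ∑ p ∈ Ps, ∑ n ∈ Icc 1 (N / p), f (p * n) / ((p * n : ℕ) : ℂ) := by
    simp only [mul_sum]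
    rw [sum_comm]
    refine sum_congr rfl fun p hp => ?_
    rw [← sum_Icc_filter_dvd N p (hPs p hp).1.pos (fun m => f m / (m : ℂ)), sum_filter]
    simp
  rw [e1, ← sum_sub_distrib, sum_mul]
  refine (norm_sum_le _ _).trans (sum_le_sum fun p hp => ?_)
  have hp := hPs p hp
  have hp0 : (0 : ℝ) < p := by exact_mod_cast hp.1.pos
  have hsub : Icc 1 (N / p) ⊆ Icc 1 N := Icc_subset_Icc_right (Nat.div_le_self N p)
  rw [norm_sub_rev, ← sum_sdiff hsub, add_sub_cancel_right]
  have h1 : ‖∑ n ∈ Icc 1 N \ Icc 1 (N / p), f (p * n) / ((p * n : ℕ) : ℂ)‖ ≤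
      ∑ n ∈ Icc 1 N \ Icc 1 (N / p), (1 : ℝ) / ((p * n : ℕ) : ℝ) := by
    refine (norm_sum_le _ _).trans (sum_le_sum fun n _ => ?_)
    rw [norm_div, Complex.norm_natCast]
    gcongr
    exact hf _
  have h2 := sum_sdiff (f := fun n => (1 : ℝ) / ((p * n : ℕ) : ℝ)) hsub
  rw [← sum_Icc_filter_dvd N p hp.1.pos (fun m => (1 : ℝ) / (m : ℝ))] at h2
  have h3 := (sum_multiples_one_div_bounds hp.1.pos (hN p ‹_›)).1
  have h4 : ∑ n ∈ Icc 1 N, (1 : ℝ) / ((p * n : ℕ) : ℝ) ≤ (1 + Real.log N) / p := by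
    have := (sum_Icc_one_div_bounds (x := N) (by exact_mod_cast hN1)).2
    rw [Nat.floor_natCast] at this
    refine le_trans (le_of_eq ?_) (div_le_div_of_nonneg_right this hp0.le)
    rw [sum_div]
    refine sum_congr rfl fun n _ => ?_
    push_cast
    rw [div_div, mul_comm]
  have h5 : Real.log p ≤ Real.log P := Real.log_le_log hp0 hp.2
  have h6 : (1 + Real.log N) / p - (Real.log N - Real.log p) / p ≤ 1 / p * (1 + Real.log P) := by
    rw [← sub_div, one_div_mul_eq_div]
    gcongr
    linarith
  linarith

/-- Lemma A.5 of the paper: logarithmic Elliott inequality. -/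
theorem elliott_inequality :
    ∃ C : ℝ, 0 < C ∧
      ∀ (N : ℕ) (P : ℝ) (Ps : Finset ℕ) (f : ℕ → ℂ),
        2 ≤ N → Ps.Nonempty → (∀ p ∈ Ps, Nat.Prime p ∧ (p : ℝ) ≤ P) →
        (∀ n, ‖f n‖ ≤ 1) →
        ‖logAvgC (Finset.Icc 1 N) f -
            logAvgC (Finset.Icc 1 N) (fun n => logAvgC Ps (fun p => f (p * n)))‖ ≤
          C * (Real.log P / Real.log N +
                (∑ p ∈ Ps, (1 : ℝ) / p) ^ (-(1 / 2 : ℝ))) := by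
  refine ⟨6, by norm_num, fun N P Ps f hN2 hne hPs hf => ?_⟩
  have hN1 : 1 ≤ N := by omega
  obtain ⟨p₀, hp₀⟩ := hne
  have hP2 : 2 ≤ P := le_trans (by exact_mod_cast (hPs p₀ hp₀).1.two_le) (hPs p₀ hp₀).2
  have hlogP : 1 ≤ 2 * Real.log P := by
    have := Real.log_le_log two_pos hP2
    have := Real.log_two_gt_d9
    linarith
  have hL : 0 < Real.log N := Real.log_pos (by exact_mod_cast hN2)
  set A := ∑ p ∈ Ps, (1 : ℝ) / p with hA
  set H := ∑ m ∈ Icc 1 N, (1 : ℝ) / m with hH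
  have hA0 : 0 < A := sum_pos
    (fun p hp => one_div_pos.2 (by exact_mod_cast (hPs p hp).1.pos)) ⟨p₀, hp₀⟩
  have hLH : Real.log N ≤ H := by
    have := (sum_Icc_one_div_bounds (x := N) (by exact_mod_cast hN1)).1
    rwa [Nat.floor_natCast] at this
  have hH0 : 0 < H := hL.trans_le hLH
  have hAP : A ≤ 1 + Real.log P := by
    refine le_trans ?_ (sum_Icc_one_div_bounds (x := P) (by linarith)).2
    refine sum_le_sum_of_subset_of_nonneg (fun p hp => ?_) (fun i _ _ => by positivity)
    exact mem_Icc.2 ⟨(hPs p hp).1.pos, Nat.le_floor (hPs p hp).2⟩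
  have hr0 : 0 ≤ A ^ (-(1 / 2 : ℝ)) := by positivity
  by_cases hcase : Real.log N < 3 * Real.log P
  · have h1 : (1 : ℝ) / 3 ≤ Real.log P / Real.log N := by
      rw [div_le_div_iff₀ (by norm_num) hL]; linarith
    have h2 := norm_sub_le (logAvgC (Icc 1 N) f)
      (logAvgC (Icc 1 N) (fun n => logAvgC Ps (fun p => f (p * n))))
    have h3 := norm_logAvgC_le_one (Icc 1 N) hf
    have h4 := norm_logAvgC_le_one (Icc 1 N)
      (fun n => norm_logAvgC_le_one Ps (f := fun p => f (p * n)) (fun p => hf _))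
    linarith
  push Not at hcase
  have hPP : ∀ p ∈ Ps, ∀ q ∈ Ps, p * q ≤ N := by
    intro p hp q hq
    have hp0 : (0 : ℝ) < p := by exact_mod_cast (hPs p hp).1.pos
    have hq0 : (0 : ℝ) < q := by exact_mod_cast (hPs q hq).1.pos
    have h1 := Real.log_le_log hp0 (hPs p hp).2
    have h2 := Real.log_le_log hq0 (hPs q hq).2
    have h3 : Real.log ((p : ℝ) * q) ≤ Real.log N := by
      rw [Real.log_mul hp0.ne' hq0.ne']; linarith
    rw [Real.log_le_log_iff (by positivity) (by positivity)] at h3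
    exact_mod_cast h3
  have hpN : ∀ p ∈ Ps, p ≤ N := fun p hp => (Nat.le_mul_self p).trans (hPP p hp p hp)
  have hAH : A ≤ H := by linarith
  set F := ∑ m ∈ Icc 1 N, f m / (m : ℂ) with hF
  set G := ∑ p ∈ Ps, ∑ n ∈ Icc 1 N, f (p * n) / ((p * n : ℕ) : ℂ) with hG
  set M := ∑ m ∈ Icc 1 N, f m / m * (∑ p ∈ Ps, if p ∣ m then (1 : ℂ) else 0) with hM
  have hAc : ∑ p ∈ Ps, (1 : ℂ) / (p : ℂ) = (A : ℂ) := by rw [hA]; push_cast; rfl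
  have hHc : ∑ p ∈ Icc 1 N, (1 : ℂ) / (p : ℂ) = (H : ℂ) := by rw [hH]; push_cast; rfl
  have hAne : (A : ℂ) ≠ 0 := by exact_mod_cast hA0.ne'
  have hHne : (H : ℂ) ≠ 0 := by exact_mod_cast hH0.ne'
  have hdiff : logAvgC (Icc 1 N) f -
      logAvgC (Icc 1 N) (fun n => logAvgC Ps (fun p => f (p * n))) =
      ((A * F - M) + (M - G)) / ((A * H : ℝ) : ℂ) := by
    have : ∑ n ∈ Icc 1 N, (∑ p ∈ Ps, f (p * n) / (p : ℂ)) / (A : ℂ) / (n : ℂ) = G / A := by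
      rw [hG, sum_comm, sum_div]
      refine sum_congr rfl fun n _ => ?_
      rw [div_right_comm, sum_div]
      congr 1
      refine sum_congr rfl fun p _ => ?_
      push_cast
      rw [div_div]
    simp only [logAvgC, hAc, hHc, this]
    rw [← hF]
    push_cast
    field_simp
    ring
  have hMG : ‖M - G‖ ≤ A * (1 + Real.log P) := norm_sum_sub_sum_dilate_le hPs hpN hN1 hf
  have hTK := log_turan_kubilius (fun p hp => (hPs p hp).1) hPP hN1
  rw [← hA, ← hH] at hTK
  have hFM : ‖A * F - M‖ ^ 2 ≤ H * (3 * A * H) := by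
    have h1 : ‖A * F - M‖ ≤ ∑ m ∈ Icc 1 N, (1 : ℝ) / m *
        |(∑ p ∈ Ps, if p ∣ m then (1 : ℝ) else 0) - A| := by
      rw [hF, hM, mul_sum, ← sum_sub_distrib]
      refine (norm_sum_le _ _).trans (sum_le_sum fun m _ => ?_)
      have : (A : ℂ) * (f m / m) - f m / m * (∑ p ∈ Ps, if p ∣ m then (1 : ℂ) else 0) =
          -(f m / m * (((∑ p ∈ Ps, if p ∣ m then (1 : ℝ) else 0) - A : ℝ) : ℂ)) := by
        simp only [Complex.ofReal_sub, Complex.ofReal_sum, apply_ite Complex.ofReal,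
          Complex.ofReal_one, Complex.ofReal_zero]
        ring
      rw [this, norm_neg, norm_mul, norm_div, Complex.norm_natCast, Complex.norm_real,
        Real.norm_eq_abs]
      gcongr
      exact hf m
    have h2 := sum_sq_le_sum_mul_sum_of_sq_le_mul (Icc 1 N)
      (f := fun m : ℕ => (1 : ℝ) / m)
      (g := fun m : ℕ => (1 : ℝ) / m * ((∑ p ∈ Ps, if p ∣ m then (1 : ℝ) else 0) - A) ^ 2)
      (r := fun m : ℕ => (1 : ℝ) / m * |(∑ p ∈ Ps, if p ∣ m then (1 : ℝ) else 0) - A|)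
      (fun _ _ => by positivity) (fun _ _ => by positivity)
      (fun _ _ => le_of_eq (by rw [mul_pow, sq_abs]; ring))
    refine (pow_le_pow_left₀ (norm_nonneg _) h1 2).trans (h2.trans ?_)
    refine mul_le_mul_of_nonneg_left (hTK.trans ?_) hH0.le
    nlinarith
  have hr : (A ^ (-(1 / 2 : ℝ))) ^ 2 * A = 1 := by
    rw [← Real.rpow_natCast, ← Real.rpow_mul hA0.le]
    norm_num
    rw [Real.rpow_neg_one, inv_mul_cancel₀ hA0.ne']
  have hFM' : ‖A * F - M‖ ≤ A * H * (2 * A ^ (-(1 / 2 : ℝ))) := by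
    refine abs_le_of_sq_le_sq' ?_ (by positivity) |>.2
    have h : (A * H * (2 * A ^ (-(1 / 2 : ℝ)))) ^ 2 =
        4 * A * H ^ 2 * ((A ^ (-(1 / 2 : ℝ))) ^ 2 * A) := by ring
    rw [h, hr]
    nlinarith [mul_nonneg hA0.le (sq_nonneg H)]
  rw [hdiff, norm_div, Complex.norm_real, Real.norm_of_nonneg (by positivity),
    div_le_iff₀ (by positivity)]
  refine (norm_add_le _ _).trans ((add_le_add hFM' hMG).trans ?_)
  have h1 : A * (1 + Real.log P) ≤ A * H * (3 * (Real.log P / Real.log N)) := by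
    rw [mul_assoc]
    refine mul_le_mul_of_nonneg_left ?_ hA0.le
    have : Real.log P = Real.log N * (Real.log P / Real.log N) := by field_simp
    have h2 : 0 ≤ Real.log P / Real.log N := div_nonneg (by linarith) hL.le
    nlinarith [mul_le_mul_of_nonneg_right hLH h2]
  have h2 : 0 ≤ Real.log P / Real.log N := div_nonneg (by linarith) hL.le
  have h3 : 0 ≤ A * H := by positivity
  nlinarith [mul_nonneg h3 h2, mul_nonneg h3 hr0]
end
end
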